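/- arXiv:0812.2921 — 4 statements merged into one kernel-verified Lean document; each statement's English description precedes it below -/
import Mathlib

section
/- Let ρ and σ be coprime integers with σ ≠ 0 and |ρ| > |σ|, and set q = ρ/σ (regarded as a complex number, so |q| > 1). Let α be a nonzero complex number and let μ = Σ_{n=0}^∞ α^n · q^{−n(n+1)/2} (the value F_q(α;0) of the Tschakaloff-type series). If log|ρ| > (252π² / (173π² − 72√3·L)) · log|σ|, where L = Σ_{n=1}^∞ sin(2πn/3)/n², then α and μ are not both rational numbers. -/
open scoped BigOperators

section Prerequisites

open Polynomial Finset

section Moments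

variable {R : Type*} [CommRing R]

/-- The sequence solving `w (n + 1) = b q ^ (n + 1) (w n - c a ^ n)` with `w 0 = m`. -/
def momentSeq (q a b c m : R) : ℕ → R
  | 0 => m
  | n + 1 => b * q ^ (n + 1) * (momentSeq q a b c m n - c * a ^ n)

theorem momentSeq_succ (q a b c m : R) (n : ℕ) :
    momentSeq q a b c m (n + 1) = b * q ^ (n + 1) * (momentSeq q a b c m n - c * a ^ n) := rfl

theorem map_momentSeq {S : Type*} [CommRing S] (f : R →+* S) (q a b c m : R) (n : ℕ) :
    f (momentSeq q a b c m n) = momentSeq (f q) (f a) (f b) (f c) (f m) n := by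
  induction n with
  | zero => rfl
  | succ n ih => simp [momentSeq_succ, ih]

/-- The linear functional on polynomials with prescribed moments. -/
noncomputable def momentFunctional (w : ℕ → R) : R[X] →ₗ[R] R :=
  Polynomial.lsum fun n => LinearMap.toSpanSingleton R R (w n)

theorem momentFunctional_C_mul_X_pow (w : ℕ → R) (r : R) (n : ℕ) :
    momentFunctional w (C r * X ^ n) = r * w n := by
  simp [momentFunctional, C_mul_X_pow_eq_monomial, Polynomial.lsum_apply]

theorem momentFunctional_X_pow (w : ℕ → R) (n : ℕ) : momentFunctional w (X ^ n) = w n := by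
  simpa using momentFunctional_C_mul_X_pow w 1 n

theorem momentFunctional_C_mul (w : ℕ → R) (r : R) (P : R[X]) :
    momentFunctional w (C r * P) = r * momentFunctional w P := by
  rw [← smul_eq_C_mul, map_smul, smul_eq_mul]

theorem momentFunctional_mul_X_pow (w : ℕ → R) {P : R[X]} {N : ℕ} (hP : P.natDegree < N) (n : ℕ) :
    momentFunctional w (P * X ^ n) = ∑ k ∈ range N, P.coeff k * w (k + n) := by
  conv_lhs => rw [P.as_sum_range' N hP, Finset.sum_mul, map_sum]
  refine Finset.sum_congr rfl fun k _ => ?_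
  rw [← C_mul_X_pow_eq_monomial, mul_assoc, ← pow_add, momentFunctional_C_mul_X_pow]

theorem momentFunctional_mul (w : ℕ → R) {P Q : R[X]} {N : ℕ} (hP : P.natDegree < N)
    (hQ : Q.natDegree < N) :
    momentFunctional w (P * Q) =
      ∑ k ∈ range N, ∑ l ∈ range N, P.coeff k * w (k + l) * Q.coeff l := by
  conv_lhs => rw [Q.as_sum_range' N hQ, Finset.mul_sum, map_sum]
  rw [Finset.sum_comm]
  refine Finset.sum_congr rfl fun l _ => ?_
  rw [← C_mul_X_pow_eq_monomial, mul_left_comm, momentFunctional_C_mul,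
    momentFunctional_mul_X_pow w hP, Finset.mul_sum]
  exact Finset.sum_congr rfl fun k _ => by ring

/-- The Hankel matrix of a sequence. -/
def hankelMatrix (w : ℕ → R) (N : ℕ) : Matrix (Fin N) (Fin N) R :=
  Matrix.of fun i j => w (i + j)

theorem det_coeff_monic {P : ℕ → R[X]} (hm : ∀ i, (P i).Monic) (hd : ∀ i, (P i).natDegree = i)
    (N : ℕ) : (Matrix.of fun i j : Fin N => (P i).coeff j).det = 1 := by
  rw [Matrix.det_of_isLowerTriangular]
  · refine Finset.prod_eq_one fun i _ => ?_
    have := hm i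
    rw [Monic, leadingCoeff, hd] at this
    simpa using this
  · intro i j hij
    refine coeff_eq_zero_of_natDegree_lt ?_
    rw [hd]
    exact hij

theorem det_momentFunctional_mul (w : ℕ → R) {P Q : ℕ → R[X]} (hPm : ∀ i, (P i).Monic)
    (hPd : ∀ i, (P i).natDegree = i) (hQm : ∀ i, (Q i).Monic) (hQd : ∀ i, (Q i).natDegree = i)
    (N : ℕ) :
    (Matrix.of fun i j : Fin N => momentFunctional w (P i * Q j)).det =
      (hankelMatrix w N).det := by
  have h : (Matrix.of fun i j : Fin N => momentFunctional w (P i * Q j)) =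
      (Matrix.of fun i j : Fin N => (P i).coeff j) * hankelMatrix w N *
        (Matrix.of fun i j : Fin N => (Q i).coeff j).transpose := by
    ext i j
    rw [Matrix.of_apply, momentFunctional_mul w (N := N) (by rw [hPd]; exact i.2)
      (by rw [hQd]; exact j.2), Finset.sum_comm]
    simp only [Matrix.mul_apply, Matrix.of_apply, Matrix.transpose_apply, hankelMatrix,
      Finset.sum_mul, Finset.sum_range]
  rw [h, Matrix.det_mul, Matrix.det_mul, Matrix.det_transpose, det_coeff_monic hPm hPd,
    det_coeff_monic hQm hQd, one_mul, mul_one]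

theorem pow_dvd_det {z : R} {N : ℕ} {A : Matrix (Fin N) (Fin N) R} {k : ℕ → ℕ → ℕ} {e : ℕ}
    (hA : ∀ i j : Fin N, z ^ k i j ∣ A i j)
    (he : ∀ τ : Equiv.Perm (Fin N), e ≤ ∑ i, k (τ i) i) : z ^ e ∣ A.det := by
  rw [Matrix.det_apply]
  refine Finset.dvd_sum fun τ _ => ?_
  refine Dvd.dvd.trans ?_ (Units.smul_def (Equiv.Perm.sign τ) (∏ i, A (τ i) i) ▸
    (zsmul_eq_mul (∏ i, A (τ i) i) _).symm ▸ Dvd.intro_left _ rfl)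
  refine (pow_dvd_pow z (he τ)).trans ?_
  rw [← Finset.prod_pow_eq_pow_sum]
  exact Finset.prod_dvd_prod_of_dvd _ _ fun i _ => hA _ _

theorem sum_le_sum_perm {N : ℕ} {k : ℕ → ℕ → ℕ} {g : ℕ → ℕ}
    (h : ∀ i < N, ∀ j < N, g i + g j ≤ 2 * k i j) (τ : Equiv.Perm (Fin N)) :
    ∑ i ∈ range N, g i ≤ ∑ i : Fin N, k (τ i) i := by
  have h1 : ∑ i : Fin N, (g (τ i) + g i) ≤ ∑ i : Fin N, 2 * k (τ i) i :=
    Finset.sum_le_sum fun i _ => h _ (τ i).2 _ i.2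
  rw [Finset.sum_add_distrib, Equiv.sum_comp τ fun i : Fin N => g i, ← Finset.mul_sum] at h1
  rw [Finset.sum_range]
  omega

theorem natDegree_det_le {N : ℕ} {A : Matrix (Fin N) (Fin N) R[X]} {k : ℕ → ℕ → ℕ} {e : ℕ}
    (hA : ∀ i j : Fin N, (A i j).natDegree ≤ k i j)
    (he : ∀ τ : Equiv.Perm (Fin N), ∑ i, k (τ i) i ≤ e) : A.det.natDegree ≤ e := by
  rw [Matrix.det_apply]
  refine natDegree_sum_le_of_forall_le _ _ fun τ _ => ?_
  have h1 : (Equiv.Perm.sign τ • ∏ i, A (τ i) i) =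
      C ((Equiv.Perm.sign τ : ℤ) : R) * ∏ i, A (τ i) i := by
    rw [Units.smul_def, zsmul_eq_mul]; simp
  rw [h1]
  refine (natDegree_C_mul_le _ _).trans ((natDegree_prod_le _ _).trans ?_)
  exact (Finset.sum_le_sum fun i _ => hA _ _).trans (he τ)

/-- One application of the `q`-difference equation to the functional. -/
theorem momentFunctional_X_mul (q a b c m : R) (P : R[X]) :
    momentFunctional (momentSeq q a b c m) (X * P) =
      b * q * (momentFunctional (momentSeq q a b c m) (P.comp (C q * X)) - c * P.eval (a * q)) := by
  induction P using Polynomial.induction_on' with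
  | add P Q hP hQ => rw [mul_add, map_add, hP, hQ, add_comp, map_add, eval_add]; ring
  | monomial n r =>
    rw [← C_mul_X_pow_eq_monomial, mul_left_comm, ← pow_succ', momentFunctional_C_mul_X_pow,
      mul_comp, C_comp, pow_comp, X_comp, mul_pow, ← C_pow, momentFunctional_C_mul,
      momentFunctional_C_mul_X_pow, eval_mul, eval_C, eval_pow, eval_X, momentSeq_succ]
    ring

theorem dvd_momentFunctional_X_pow_mul (q a b c m : R) {z : R} (d : ℕ) (P : R[X])
    (hz : ∀ k, z ∣ P.eval (a * q ^ (k + 1))) :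
    z ∣ momentFunctional (momentSeq q a b c m) (X ^ d * P) -
      b ^ d * q ^ (d * (d + 1) / 2) *
        momentFunctional (momentSeq q a b c m) (P.comp (C (q ^ d) * X)) := by
  induction d generalizing P with
  | zero => simp
  | succ d ih =>
    have h1 : ((X : R[X]) ^ d * P).comp (C q * X) = C (q ^ d) * (X ^ d * P.comp (C q * X)) := by
      rw [mul_comp, pow_comp, X_comp, mul_pow, C_pow]; ring
    have h2 : (P.comp (C q * X)).comp (C (q ^ d) * X) = P.comp (C (q ^ (d + 1)) * X) := by
      rw [comp_assoc]
      simp only [mul_comp, C_comp, X_comp]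
      rw [← mul_assoc, ← C_mul, ← pow_succ']
    have h3 := ih (P.comp (C q * X)) fun k => by
      have := hz (k + 1)
      rw [eval_comp, eval_mul, eval_C, eval_X]
      convert this using 2; ring
    have h4 : (d + 1) * (d + 1 + 1) / 2 = d * (d + 1) / 2 + (d + 1) := by
      rw [show (d + 1) * (d + 1 + 1) = d * (d + 1) + (d + 1) * 2 by ring]
      omega
    rw [pow_succ', mul_assoc, momentFunctional_X_mul, h1, momentFunctional_C_mul, h4]
    rw [h2] at h3
    obtain ⟨s, hs⟩ := h3
    obtain ⟨t, ht⟩ := hz 0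
    rw [eval_mul, eval_pow, eval_X]
    refine ⟨b * q * q ^ d * s - b * q * c * (a * q) ^ d * t, ?_⟩
    simp only [zero_add, pow_one] at ht
    rw [ht]
    linear_combination b * q * q ^ d * hs

end Moments

section CyclotomicDivisibility

variable {R : Type*} [CommRing R]

theorem C_dvd_comp_sub (y : R) (G : R[X]) : ∃ G' : R[X], G.comp (C (1 + y) * X) = G + C y * G' := by
  have h := sub_dvd_eval_sub (C (1 + y) * X) (X : R[X]) (G.map C)
  rw [eval_map, eval_map, ← comp, ← comp, comp_X] at h
  obtain ⟨t, ht⟩ := h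
  refine ⟨X * t, ?_⟩
  have h2 : C (1 + y) * X - (X : R[X]) = C y * X := by rw [C_add, C_1]; ring
  rw [h2] at ht
  linear_combination ht

theorem pow_dvd_momentFunctional (q a b c m : R) (d : ℕ) (t : ℕ) :
    ∀ (e s : ℕ) (F : R[X]), e ≤ s → 2 * e ≤ t + 1 →
      (q ^ d - 1) ^ e ∣ momentFunctional (momentSeq q a b c m)
        ((X ^ d - C (a ^ d)) ^ s * (X ^ d - C (b ^ d * q ^ (d * (d + 1) / 2))) ^ t * F) := by
  induction t using Nat.strong_induction_on with
  | _ t ih =>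
  intro e s F hes het
  rcases t with _ | t
  · obtain rfl : e = 0 := by omega
    simp
  set y := q ^ d - 1 with hy
  set A : R[X] := X ^ d - C (a ^ d) with hA
  set l : R := b ^ d * q ^ (d * (d + 1) / 2) with hl
  set B : R[X] := X ^ d - C l with hB
  set Λ := momentFunctional (momentSeq q a b c m) with hΛ
  have hqd : q ^ d = 1 + y := by rw [hy]; ring
  obtain ⟨A', hA'⟩ := C_dvd_comp_sub y A
  obtain ⟨B', hB'⟩ := C_dvd_comp_sub y B
  obtain ⟨F', hF'⟩ := C_dvd_comp_sub y F
  have h1 := dvd_momentFunctional_X_pow_mul q a b c m (z := y ^ e) d (A ^ s * B ^ t * F) fun k => by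
    rw [mul_assoc, eval_mul, eval_pow]
    refine Dvd.dvd.mul_right ((pow_dvd_pow y hes).trans (pow_dvd_pow_of_dvd ?_ s)) _
    have : eval (a * q ^ (k + 1)) A = a ^ d * ((q ^ d) ^ (k + 1) - 1 ^ (k + 1)) := by
      simp [hA]; ring
    rw [this]
    exact Dvd.dvd.mul_left (sub_dvd_pow_sub_pow (q ^ d) 1 (k + 1)) _
  have h2 : A ^ s * B ^ (t + 1) * F = X ^ d * (A ^ s * B ^ t * F) - C l * (A ^ s * B ^ t * F) := by
    rw [hB]; ring
  have h3 : y ^ e ∣ Λ ((A ^ s * B ^ t * F).comp (C (q ^ d) * X)) - Λ (A ^ s * B ^ t * F) := by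
    rw [hqd]
    simp only [mul_comp, pow_comp]
    rw [hA', hB', hF', add_comm A, add_comm B, add_pow, add_pow, Finset.sum_mul_sum,
      ← Finset.sum_product', ← Finset.add_sum_erase _ _ (a := ((0, 0) : ℕ × ℕ)) (by simp)]
    simp only [pow_zero, Nat.sub_zero, one_mul, Nat.choose_zero_right, Nat.cast_one, mul_one]
    rw [add_mul, map_add, Finset.sum_mul, map_sum, mul_add, map_add, add_assoc,
      add_sub_cancel_left]
    refine dvd_add ?_ (Finset.dvd_sum fun p hp => ?_)
    · rw [mul_left_comm, momentFunctional_C_mul]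
      rcases e with _ | e
      · simp
      · rw [pow_succ']
        exact mul_dvd_mul_left _ (ih t (by omega) e s _ (by omega) (by omega))
    · rw [Finset.mem_erase, Finset.mem_product, Finset.mem_range, Finset.mem_range] at hp
      obtain ⟨hp0, hp1, hp2⟩ := hp
      have hpos : 1 ≤ p.1 + p.2 := by
        by_contra hcon
        exact hp0 (Prod.ext (by simp; omega) (by simp; omega))
      have h4 : (C y * A') ^ p.1 * A ^ (s - p.1) * (s.choose p.1 : R[X]) *
          ((C y * B') ^ p.2 * B ^ (t - p.2) * (t.choose p.2 : R[X])) * (F + C y * F') =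
          C (y ^ (p.1 + p.2)) * (A ^ (s - p.1) * B ^ (t - p.2) *
            (A' ^ p.1 * B' ^ p.2 * (s.choose p.1 : R[X]) * (t.choose p.2 : R[X]) *
              (F + C y * F'))) := by
        rw [C_pow]; ring
      rw [h4, momentFunctional_C_mul]
      rcases le_total e (p.1 + p.2) with he | he
      · exact Dvd.dvd.mul_right (pow_dvd_pow _ he) _
      · obtain ⟨f, rfl⟩ := Nat.exists_eq_add_of_le he
        rw [pow_add]
        exact mul_dvd_mul_left _ (ih (t - p.2) (by omega) f (s - p.1) _ (by omega) (by omega))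
  rw [h2, map_sub, momentFunctional_C_mul]
  obtain ⟨u, hu⟩ := h1
  obtain ⟨v, hv⟩ := h3
  exact ⟨u + l * v, by linear_combination hu + l * hv⟩

/-- The `q ^ d - 1` part of the Hankel determinant. -/
theorem pow_dvd_det_hankelMatrix (q a b c m : R) {d : ℕ} (hd : 0 < d) (N : ℕ) :
    (q ^ d - 1) ^ (∑ i ∈ range N, 2 * (i / d) / 3) ∣
      (hankelMatrix (momentSeq q a b c m) N).det := by
  nontriviality R
  let A : R[X] := X ^ d - C (a ^ d)
  let B : R[X] := X ^ d - C (b ^ d * q ^ (d * (d + 1) / 2))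
  let s : ℕ → ℕ := fun i => (i / d + 1) / 3
  let t : ℕ → ℕ := fun i => i / d - s i
  let P : ℕ → R[X] := fun i => A ^ s i * B ^ t i * X ^ (i % d)
  have hAm : A.Monic := monic_X_pow_sub_C _ hd.ne'
  have hBm : B.Monic := monic_X_pow_sub_C _ hd.ne'
  have hPm : ∀ i, (P i).Monic := fun i => ((hAm.pow _).mul (hBm.pow _)).mul (monic_X_pow _)
  have hPd : ∀ i, (P i).natDegree = i := fun i => by
    have hst : s i + t i = i / d := by simp only [s, t]; generalize i / d = u; omega
    have := Nat.div_add_mod i d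
    rw [((hAm.pow _).mul (hBm.pow _)).natDegree_mul (monic_X_pow _),
      (hAm.pow _).natDegree_mul (hBm.pow _), hAm.natDegree_pow, hBm.natDegree_pow,
      natDegree_X_pow_sub_C, natDegree_X_pow_sub_C, natDegree_X_pow, ← add_mul, hst, mul_comm]
    exact this
  rw [← det_momentFunctional_mul _ hPm hPd hPm hPd N]
  refine pow_dvd_det (k := fun i j => min (s i + s j) ((t i + t j + 1) / 2)) (fun i j => ?_)
    fun τ => sum_le_sum_perm (k := fun i j => min (s i + s j) ((t i + t j + 1) / 2))
      (g := fun i => 2 * (i / d) / 3) (fun i _ j _ => ?_) τ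
  · have h : P i * P j = A ^ (s i + s j) * B ^ (t i + t j) * (X ^ (i % d : ℕ) * X ^ (j % d : ℕ)) := by
      simp only [P]; ring
    rw [Matrix.of_apply, h]
    exact pow_dvd_momentFunctional q a b c m d _ _ _ _ (min_le_left _ _) (by omega)
  · simp only [s, t]
    generalize i / d = u
    generalize j / d = v
    omega

end CyclotomicDivisibility

section OrderAtZero

variable {R : Type*} [CommRing R]

/-- The monic polynomial with roots `θ 0, …, θ (s - 1)`. -/
noncomputable def nodePoly (θ : ℕ → R) (s : ℕ) : R[X] := ∏ l ∈ range s, (X - C (θ l))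

theorem nodePoly_zero (θ : ℕ → R) : nodePoly θ 0 = 1 := by simp [nodePoly]

theorem nodePoly_succ (θ : ℕ → R) (s : ℕ) :
    nodePoly θ (s + 1) = nodePoly θ s * (X - C (θ s)) := Finset.prod_range_succ _ _

theorem nodePoly_monic (θ : ℕ → R) (s : ℕ) : (nodePoly θ s).Monic :=
  monic_prod_of_monic _ _ fun _ _ => monic_X_sub_C _

theorem natDegree_nodePoly [Nontrivial R] (θ : ℕ → R) (s : ℕ) : (nodePoly θ s).natDegree = s := by
  rw [nodePoly, natDegree_prod_of_monic _ _ fun _ _ => monic_X_sub_C _]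
  simp

theorem momentFunctional_nodePoly_succ (w θ : ℕ → R) (s n : ℕ) :
    momentFunctional w (nodePoly θ (s + 1) * X ^ n) =
      momentFunctional w (nodePoly θ s * X ^ (n + 1)) -
        θ s * momentFunctional w (nodePoly θ s * X ^ n) := by
  rw [← momentFunctional_C_mul, ← map_sub, nodePoly_succ]
  congr 1
  ring

theorem momentFunctional_nodePoly_succ_succ (q a b c m : R) (s n : ℕ) :
    momentFunctional (momentSeq q a b c m)
        (nodePoly (fun l => a * q ^ (l + 1)) (s + 1) * X ^ (n + 1)) =
      b * q ^ (s + n + 2) *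
        (momentFunctional (momentSeq q a b c m) (nodePoly (fun l => a * q ^ (l + 1)) s * X ^ (n + 1))
          - a * momentFunctional (momentSeq q a b c m)
            (nodePoly (fun l => a * q ^ (l + 1)) s * X ^ n)) := by
  induction s generalizing n with
  | zero =>
    rw [momentFunctional_nodePoly_succ]
    simp only [nodePoly_zero, one_mul, momentFunctional_X_pow, momentSeq_succ]
    ring
  | succ s ih =>
    have h (s n : ℕ) := momentFunctional_nodePoly_succ (momentSeq q a b c m)
      (fun l => a * q ^ (l + 1)) s n
    linear_combination h (s + 1) (n + 1) + ih (n + 1) - a * q ^ (s + 1 + 1) * ih n -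
      b * q ^ (s + n + 3) * h s (n + 1) + b * q ^ (s + n + 3) * a * h s n

theorem pow_dvd_momentFunctional_nodePoly (q a b c m : R) (s n : ℕ) :
    q ^ (if n ≤ s then (s + n) ^ 2 / 4 else s * n) ∣ momentFunctional (momentSeq q a b c m)
      (nodePoly (fun l => a * q ^ (l + 1)) s * X ^ n) := by
  induction s generalizing n with
  | zero =>
    rcases n with _ | n <;> simp
  | succ s ih =>
    rcases n with _ | n
    · rw [momentFunctional_nodePoly_succ]
      refine dvd_sub ((pow_dvd_pow q ?_).trans (ih 1)) ?_
      · rcases s with _ | s <;> simp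
      · rw [mul_assoc]
        refine Dvd.dvd.mul_left ((pow_dvd_pow q ?_).trans
          ((pow_add q (s + 1) _).symm ▸ mul_dvd_mul_left (q ^ (s + 1)) (ih 0))) a
        simp only [Nat.zero_le, if_true, add_zero]
        rw [show (s + 1) ^ 2 = s ^ 2 + 2 * s + 1 by ring]
        omega
    · rw [momentFunctional_nodePoly_succ_succ, mul_assoc]
      refine Dvd.dvd.mul_left ?_ b
      rw [mul_sub]
      refine dvd_sub ?_ ?_
      · refine (pow_dvd_pow q ?_).trans
          ((pow_add q (s + n + 2) _).symm ▸ mul_dvd_mul_left (q ^ (s + n + 2)) (ih (n + 1)))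
        rcases lt_trichotomy n s with h | rfl | h
        · rw [if_pos (by omega), if_pos (by omega)]
          have h1 : (s + 1 + (n + 1)) ^ 2 = (s + n) ^ 2 + 4 * (s + n + 1) := by ring
          have h2 : (s + (n + 1)) ^ 2 = (s + n) ^ 2 + 2 * (s + n) + 1 := by ring
          omega
        · rw [if_pos (by omega), if_neg (by omega)]
          have h1 : (n + 1 + (n + 1)) ^ 2 = 4 * ((n + 1) * (n + 1)) := by ring
          rw [h1, Nat.mul_div_cancel_left _ (by norm_num)]
          nlinarith
        · rw [if_neg (by omega), if_neg (by omega)]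
          nlinarith
      · rw [mul_left_comm]
        refine Dvd.dvd.mul_left ?_ a
        refine (pow_dvd_pow q ?_).trans
          ((pow_add q (s + n + 2) _).symm ▸ mul_dvd_mul_left (q ^ (s + n + 2)) (ih n))
        rcases le_or_gt n s with h | h
        · rw [if_pos (by omega), if_pos (by omega)]
          have h1 : (s + 1 + (n + 1)) ^ 2 = (s + n) ^ 2 + 4 * (s + n + 1) := by ring
          omega
        · rw [if_neg (by omega), if_neg (by omega)]
          nlinarith

theorem le_sum_perm_order (N : ℕ) (τ : Equiv.Perm (Fin N)) :
    5 / 24 * (N : ℝ) ^ 3 - N ^ 2 ≤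
      ((∑ i : Fin N, if (i : ℕ) ≤ τ i then ((τ i : ℕ) + i) ^ 2 / 4 else (τ i : ℕ) * i : ℕ) : ℝ) := by
  set h : ℝ := N / 2 with hh
  let f : ℝ → ℝ := fun x => if x ≤ h then 4 * h * x - x ^ 2 else 2 * h * x + h ^ 2
  let g : ℝ → ℝ := fun y => if y ≤ h then 2 * h * y - 3 * h ^ 2 else 4 * h * y - y ^ 2 - 4 * h ^ 2
  have hfg : ∀ x y : ℕ, 2 * (f x + g y) - 1 ≤
      4 * ((if y ≤ x then (x + y) ^ 2 / 4 else x * y : ℕ) : ℝ) := fun x y => by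
    have h0 : (0 : ℝ) ≤ h := by positivity
    rcases le_or_gt y x with hyx | hyx
    · rw [if_pos hyx]
      have h1 : ((x : ℝ) + y) ^ 2 ≤ 4 * (((x + y) ^ 2 / 4 : ℕ) : ℝ) + 1 := by
        have h2 : (x + y) ^ 2 ≤ 4 * ((x + y) ^ 2 / 4) + 1 := by
          have : (x + y) ^ 2 % 4 ≤ 1 := by
            have h3 : (x + y) % 4 < 4 := Nat.mod_lt _ (by norm_num)
            rw [Nat.pow_mod]
            interval_cases (x + y) % 4 <;> norm_num
          omega
        exact_mod_cast h2
      have hyx' : (y : ℝ) ≤ x := by exact_mod_cast hyx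
      simp only [f, g]
      split_ifs with h2 h3 h3
      · nlinarith [sq_nonneg ((h - x) + (h - y)), sq_nonneg (h - x)]
      · nlinarith
      · nlinarith [sq_nonneg ((x : ℝ) + y - 2 * h)]
      · nlinarith [sq_nonneg ((x : ℝ) + y - 2 * h), sq_nonneg (y - h)]
    · rw [if_neg (by omega)]
      have hyx' : (x : ℝ) ≤ y := by exact_mod_cast hyx.le
      push_cast
      simp only [f, g]
      split_ifs with h2 h3 h3
      · nlinarith [mul_nonneg (sub_nonneg.2 h2) (sub_nonneg.2 h3), sq_nonneg (h - x)]
      · nlinarith [sq_nonneg ((x : ℝ) + y - 2 * h)]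
      · nlinarith
      · nlinarith [mul_nonneg (sub_nonneg.2 (not_le.1 h2).le) (sub_nonneg.2 (not_le.1 h3).le),
          sq_nonneg (y - h)]
  have hdiag : ∀ x : ℝ, f x + g x = 6 * h * x - x ^ 2 - 3 * h ^ 2 := fun x => by
    simp only [f, g]
    split_ifs <;> ring
  have h1 : ∑ i : Fin N, (2 * (f (τ i : ℕ) + g (i : ℕ)) - 1) ≤ ∑ i : Fin N,
      4 * ((if (i : ℕ) ≤ τ i then ((τ i : ℕ) + i) ^ 2 / 4 else (τ i : ℕ) * i : ℕ) : ℝ) :=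
    Finset.sum_le_sum fun i _ => hfg _ _
  have h2 : ∑ i : Fin N, (2 * (f (τ i : ℕ) + g (i : ℕ)) - 1) =
      ∑ i ∈ range N, (2 * (6 * h * i - (i : ℝ) ^ 2 - 3 * h ^ 2) - 1) := by
    rw [Finset.sum_range]
    simp only [← hdiag, Finset.sum_sub_distrib, ← Finset.mul_sum, Finset.sum_add_distrib]
    rw [Equiv.sum_comp τ fun i : Fin N => f (i : ℕ)]
  have h3 : ∀ n : ℕ, ∑ i ∈ range n, (2 * (6 * h * i - (i : ℝ) ^ 2 - 3 * h ^ 2) - 1) =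
      6 * h * n * (n - 1) - (n : ℝ) * (n - 1) * (2 * n - 1) / 3 - 6 * h ^ 2 * n - n := fun n => by
    induction n with
    | zero => simp
    | succ n ih => rw [Finset.sum_range_succ, ih]; push_cast; ring
  rw [← Finset.mul_sum, h2, h3, hh] at h1
  push_cast at h1 ⊢
  have hN : (N : ℝ) ≤ N ^ 2 := by exact_mod_cast Nat.le_self_pow two_ne_zero N
  nlinarith

/-- The `q` part of the Hankel determinant. -/
theorem exists_pow_dvd_det_hankelMatrix [Nontrivial R] (q a b c m : R) (N : ℕ) :
    ∃ e : ℕ, 5 / 24 * (N : ℝ) ^ 3 - N ^ 2 ≤ e ∧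
      q ^ e ∣ (hankelMatrix (momentSeq q a b c m) N).det := by
  let M : Equiv.Perm (Fin N) → ℕ := fun τ =>
    ∑ i : Fin N, if (i : ℕ) ≤ τ i then ((τ i : ℕ) + i) ^ 2 / 4 else (τ i : ℕ) * i
  obtain ⟨τ₀, -, hτ₀⟩ := Finset.exists_min_image Finset.univ M ⟨1, Finset.mem_univ _⟩
  refine ⟨M τ₀, le_sum_perm_order N τ₀, ?_⟩
  rw [← det_momentFunctional_mul _ (nodePoly_monic fun l => a * q ^ (l + 1))
    (natDegree_nodePoly _) (Q := fun j => X ^ j) monic_X_pow natDegree_X_pow N]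
  exact pow_dvd_det (k := fun s n => if n ≤ s then (s + n) ^ 2 / 4 else s * n)
    (fun i j => pow_dvd_momentFunctional_nodePoly q a b c m i j) fun τ =>
      hτ₀ τ (Finset.mem_univ _)

end OrderAtZero

section Degree

variable {R : Type*} [CommRing R]

theorem natDegree_momentSeq_le (a b c m : R) (n : ℕ) :
    (momentSeq X (C a) (C b) (C c) (C m) n).natDegree ≤ n * (n + 1) / 2 := by
  induction n with
  | zero => simp [momentSeq]
  | succ n ih =>
    have h1 : (n + 1) * (n + 1 + 1) / 2 = n * (n + 1) / 2 + (n + 1) := by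
      rw [show (n + 1) * (n + 1 + 1) = n * (n + 1) + (n + 1) * 2 by ring]
      omega
    rw [momentSeq_succ, h1, mul_assoc]
    refine (natDegree_C_mul_le _ _).trans (natDegree_mul_le.trans ?_)
    rw [add_comm]
    refine add_le_add ((natDegree_sub_le _ _).trans (max_le ih ?_)) (natDegree_X_pow_le _)
    rw [← C_pow, ← C_mul, natDegree_C]
    exact Nat.zero_le _

theorem natDegree_det_hankelMatrix_le (a b c m : R) (N : ℕ) :
    (hankelMatrix (momentSeq X (C a) (C b) (C c) (C m)) N).det.natDegree ≤
      ∑ i ∈ range N, i * (2 * i + 1) := by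
  refine natDegree_det_le (k := fun i j => (i + j) * (i + j + 1) / 2)
    (fun i j => natDegree_momentSeq_le a b c m _) fun τ => ?_
  have h1 : ∀ i j : ℕ, 2 * ((i + j) * (i + j + 1) / 2) ≤ i * (2 * i + 1) + j * (2 * j + 1) := by
    intro i j
    refine (Nat.mul_div_le _ _).trans ?_
    zify
    nlinarith [sq_nonneg ((i : ℤ) - j)]
  have h2 : ∑ i : Fin N, 2 * (((τ i : ℕ) + i) * ((τ i : ℕ) + i + 1) / 2) ≤
      ∑ i : Fin N, ((τ i : ℕ) * (2 * (τ i : ℕ) + 1) + (i : ℕ) * (2 * i + 1)) :=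
    Finset.sum_le_sum fun i _ => h1 _ _
  rw [← Finset.mul_sum, Finset.sum_add_distrib,
    Equiv.sum_comp τ fun i : Fin N => (i : ℕ) * (2 * i + 1)] at h2
  rw [Finset.sum_range]
  omega

end Degree

section Integrality

theorem isCoprime_X_cyclotomic_rat {d : ℕ} (hd : 0 < d) : IsCoprime (X : ℚ[X]) (cyclotomic d ℚ) := by
  refine IsCoprime.of_isCoprime_of_dvd_right ⟨X ^ (d - 1), -1, ?_⟩
    (cyclotomic.dvd_X_pow_sub_one d ℚ)
  obtain ⟨d, rfl⟩ := Nat.exists_eq_succ_of_ne_zero hd.ne'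
  simp only [Nat.succ_eq_add_one, Nat.add_sub_cancel]
  ring

theorem X_pow_mul_prod_cyclotomic_dvd {H : ℤ[X]} {s : Finset ℕ} (hs : ∀ d ∈ s, 0 < d) {o : ℕ}
    {e : ℕ → ℕ} (ho : X ^ o ∣ H) (he : ∀ d ∈ s, (X ^ d - 1) ^ e d ∣ H) :
    X ^ o * ∏ d ∈ s, cyclotomic d ℤ ^ e d ∣ H := by
  rw [← map_dvd_map (Int.castRingHom ℚ) Int.cast_injective
    ((monic_X_pow o).mul (monic_prod_of_monic _ _ fun d _ => (cyclotomic.monic d ℤ).pow _)),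
    Polynomial.map_mul, Polynomial.map_pow, Polynomial.map_prod, map_X]
  simp only [Polynomial.map_pow, map_cyclotomic]
  refine IsCoprime.mul_dvd ?_ ?_ ?_
  · exact IsCoprime.prod_right fun d hd => (isCoprime_X_cyclotomic_rat (hs d hd)).pow
  · simpa using Polynomial.map_dvd (Int.castRingHom ℚ) ho
  · refine Finset.prod_dvd_of_coprime (fun i _ j _ hij => (cyclotomic.isCoprime_rat hij).pow)
      fun d hd => ?_
    have h := Polynomial.map_dvd (Int.castRingHom ℚ)
      ((pow_dvd_pow_of_dvd (cyclotomic.dvd_X_pow_sub_one d ℤ) (e d)).trans (he d hd))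
    simpa using h

theorem abs_log_abs_one_sub_le {x : ℝ} (hx : |x| < 1) : |Real.log (1 - x)| ≤ |x| / (1 - |x|) := by
  simpa using Real.abs_log_sub_add_sum_range_le hx 0

theorem eval_cyclotomic_ne_zero {q : ℝ} (hq : 1 < |q|) {d : ℕ} (hd : 0 < d) :
    eval q (cyclotomic d ℝ) ≠ 0 := by
  intro h
  have h1 := eval_dvd (x := q) (cyclotomic.dvd_X_pow_sub_one d ℝ)
  rw [h, zero_dvd_iff, eval_sub, eval_pow, eval_X, eval_one, sub_eq_zero] at h1
  have h2 := one_lt_pow₀ hq hd.ne'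
  rw [← abs_pow, h1, abs_one] at h2
  exact lt_irrefl _ h2

/-- The values of cyclotomic polynomials at `q` are of size `|q| ^ φ(d)` up to a bounded factor. -/
theorem exists_le_log_abs_eval_cyclotomic {q : ℝ} (hq : 1 < |q|) :
    ∃ K : ℝ, 0 ≤ K ∧ ∀ d > 0,
      Nat.totient d * Real.log |q| - K ≤ Real.log |eval q (cyclotomic d ℝ)| := by
  have hq0 : q ≠ 0 := fun h => by norm_num [h] at hq
  let f : ℕ → ℝ := fun d => Real.log |eval q (cyclotomic d ℝ)| - Nat.totient d * Real.log |q|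
  let g : ℕ → ℝ := fun n => Real.log (1 - q⁻¹ ^ n)
  have hr : |q⁻¹| < 1 := by rw [abs_inv]; exact inv_lt_one_of_one_lt₀ hq
  have hrn : ∀ n > 0, |q⁻¹ ^ n| ≤ |q⁻¹| := fun n hn => by
    rw [abs_pow]
    exact pow_le_of_le_one (abs_nonneg _) hr.le (Nat.pos_iff_ne_zero.1 hn)
  have hfg : ∀ n > 0, ∑ i ∈ n.divisors, f i = g n := fun n hn => by
    simp only [f, g]
    rw [Finset.sum_sub_distrib, ← Real.log_prod, ← Finset.abs_prod, ← eval_prod,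
      prod_cyclotomic_eq_X_pow_sub_one hn, ← Finset.sum_mul, ← Nat.cast_sum, Nat.sum_totient,
      ← Real.log_pow, ← Real.log_div]
    · rw [← abs_pow, ← abs_div, Real.log_abs]
      congr 1
      simp only [eval_sub, eval_pow, eval_X, eval_one, inv_pow]
      field_simp
    · have h1 := one_lt_pow₀ hq hn.ne'
      intro h
      rw [abs_eq_zero, eval_sub, eval_pow, eval_X, eval_one, sub_eq_zero] at h
      rw [← abs_pow, h, abs_one] at h1
      exact lt_irrefl _ h1
    · positivity
    · intro i hi
      exact abs_ne_zero.2 (eval_cyclotomic_ne_zero hq (Nat.pos_of_mem_divisors hi))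
  have hg : ∀ n > 0, |g n| ≤ |q⁻¹| ^ n / (1 - |q⁻¹|) := fun n hn => by
    refine (abs_log_abs_one_sub_le ((hrn n hn).trans_lt hr)).trans ?_
    rw [← abs_pow]
    exact div_le_div_of_nonneg_left (abs_nonneg _) (by linarith) (by linarith [hrn n hn])
  have hsum : Summable fun n : ℕ => |q⁻¹| ^ n / (1 - |q⁻¹|) :=
    (summable_geometric_of_lt_one (abs_nonneg _) hr).div_const _
  have hnn : ∀ n : ℕ, 0 ≤ |q⁻¹| ^ n / (1 - |q⁻¹|) := fun n =>
    div_nonneg (by positivity) (by linarith)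
  refine ⟨∑' n : ℕ, |q⁻¹| ^ n / (1 - |q⁻¹|), tsum_nonneg hnn, fun d hd => ?_⟩
  have h1 : |f d| ≤ ∑' n : ℕ, |q⁻¹| ^ n / (1 - |q⁻¹|) := by
    rw [← ArithmeticFunction.sum_eq_iff_sum_mul_moebius_eq.1 hfg d hd]
    refine (Finset.abs_sum_le_sum_abs _ _).trans ?_
    have h2 : ∀ x ∈ d.divisorsAntidiagonal,
        |((ArithmeticFunction.moebius x.1 : ℤ) : ℝ) * g x.2| ≤ |q⁻¹| ^ x.2 / (1 - |q⁻¹|) := by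
      intro x hx
      have hx2 : 0 < x.2 := by
        rw [Nat.mem_divisorsAntidiagonal] at hx
        exact Nat.pos_of_ne_zero fun h => hx.2 (by rw [← hx.1, h, mul_zero])
      rw [abs_mul]
      have h3 : |((ArithmeticFunction.moebius x.1 : ℤ) : ℝ)| ≤ 1 := by
        exact_mod_cast ArithmeticFunction.abs_moebius_le_one
      exact (mul_le_of_le_one_left (abs_nonneg _) h3).trans (hg _ hx2)
    refine (Finset.sum_le_sum h2).trans ?_
    rw [Nat.sum_divisorsAntidiagonal' (f := fun _ y => |q⁻¹| ^ y / (1 - |q⁻¹|))]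
    exact hsum.sum_le_tsum _ fun n _ => hnn n
  have h2 := (abs_le.1 h1).1
  simp only [f] at h2
  linarith

/-- Arithmetic lower bound for nonzero values of an integer polynomial divisible by powers of the
variable and of `X ^ d - 1`. -/
theorem exists_le_log_abs_eval {ρ σ : ℤ} (hσ : 0 < σ) (hρσ : σ < |ρ|) :
    ∃ K : ℝ, 0 ≤ K ∧ ∀ (H : ℤ[X]) (s : Finset ℕ) (o D : ℕ) (e : ℕ → ℕ), (∀ d ∈ s, 0 < d) →
      X ^ o ∣ H → (∀ d ∈ s, (X ^ d - 1) ^ e d ∣ H) → H.natDegree ≤ D →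
      eval ((ρ : ℝ) / σ) (H.map (Int.castRingHom ℝ)) ≠ 0 →
      (o + ∑ d ∈ s, (e d : ℝ) * Nat.totient d) * Real.log |(ρ : ℝ)| - D * Real.log σ -
        K * ∑ d ∈ s, (e d : ℝ) ≤ Real.log |eval ((ρ : ℝ) / σ) (H.map (Int.castRingHom ℝ))| := by
  have hσ' : (0 : ℝ) < σ := by exact_mod_cast hσ
  have hσ1 : (1 : ℝ) ≤ σ := by exact_mod_cast hσ
  have hρ' : (σ : ℝ) < |(ρ : ℝ)| := by exact_mod_cast hρσ
  set q : ℝ := (ρ : ℝ) / σ with hq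
  have hqabs : |q| = |(ρ : ℝ)| / σ := by rw [hq, abs_div, abs_of_pos hσ']
  have hq1 : 1 < |q| := by rw [hqabs, one_lt_div hσ']; exact hρ'
  have hq0 : 0 < |q| := by linarith
  have hlq : Real.log |q| = Real.log |(ρ : ℝ)| - Real.log σ := by
    rw [hqabs, Real.log_div (by linarith) hσ'.ne']
  obtain ⟨K, hK, hcyc⟩ := exists_le_log_abs_eval_cyclotomic hq1
  refine ⟨K, hK, fun H s o D e hs ho he hD hne => ?_⟩
  obtain ⟨W, rfl⟩ := X_pow_mul_prod_cyclotomic_dvd hs ho he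
  rw [Polynomial.map_mul, eval_mul] at hne ⊢
  set G : ℤ[X] := X ^ o * ∏ d ∈ s, cyclotomic d ℤ ^ e d with hG
  have hGm : G.Monic :=
    (monic_X_pow o).mul (monic_prod_of_monic _ _ fun d _ => (cyclotomic.monic d ℤ).pow _)
  have hGd : G.natDegree = o + ∑ d ∈ s, e d * Nat.totient d := by
    rw [hG, (monic_X_pow o).natDegree_mul
      (monic_prod_of_monic _ _ fun d _ => (cyclotomic.monic d ℤ).pow _), natDegree_X_pow,
      natDegree_prod_of_monic _ _ fun d _ => (cyclotomic.monic d ℤ).pow _]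
    simp only [(cyclotomic.monic _ ℤ).natDegree_pow, natDegree_cyclotomic]
  have hGe : (o + ∑ d ∈ s, (e d : ℝ) * Nat.totient d) * Real.log |q| - K * ∑ d ∈ s, (e d : ℝ) ≤
      Real.log |eval q (G.map (Int.castRingHom ℝ))| := by
    rw [hG, Polynomial.map_mul, Polynomial.map_pow, Polynomial.map_prod, map_X, eval_mul, eval_pow,
      eval_X, eval_prod, abs_mul, abs_pow, Finset.abs_prod]
    simp only [Polynomial.map_pow, map_cyclotomic, eval_pow, abs_pow]
    have hne : ∀ d ∈ s, |eval q (cyclotomic d ℝ)| ^ e d ≠ 0 := fun d hd =>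
      pow_ne_zero _ (abs_ne_zero.2 (eval_cyclotomic_ne_zero hq1 (hs d hd)))
    rw [Real.log_mul (by positivity) (Finset.prod_ne_zero_iff.2 hne), Real.log_pow,
      Real.log_prod hne, add_mul, add_sub_assoc, Finset.sum_mul, Finset.mul_sum,
      ← Finset.sum_sub_distrib]
    refine add_le_add le_rfl (Finset.sum_le_sum fun d hd => ?_)
    rw [Real.log_pow]
    have := mul_le_mul_of_nonneg_left (hcyc d (hs d hd)) (Nat.cast_nonneg (α := ℝ) (e d))
    linarith
  have hW0 : eval q (W.map (Int.castRingHom ℝ)) ≠ 0 := right_ne_zero_of_mul hne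
  have hG0 : eval q (G.map (Int.castRingHom ℝ)) ≠ 0 := left_ne_zero_of_mul hne
  have hWne : W ≠ 0 := fun h => hW0 (by simp [h])
  have hWd : G.natDegree + W.natDegree ≤ D := by
    rwa [hGm.natDegree_mul' hWne] at hD
  have hWe : -(W.natDegree * Real.log σ) ≤ Real.log |eval q (W.map (Int.castRingHom ℝ))| := by
    have h1 : 1 ≤ (σ : ℝ) ^ W.natDegree * |eval q (W.map (Int.castRingHom ℝ))| :=
      one_le_pow_mul_abs_eval_div hσ hW0
    have h2 := Real.log_nonneg h1
    rw [Real.log_mul (by positivity) (abs_ne_zero.2 hW0), Real.log_pow] at h2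
    linarith
  rw [abs_mul, Real.log_mul (abs_ne_zero.2 hG0) (abs_ne_zero.2 hW0)]
  have hWd' : (o + ∑ d ∈ s, (e d : ℝ) * Nat.totient d) + W.natDegree ≤ D := by
    rw [hGd] at hWd
    exact_mod_cast hWd
  have h5 := mul_le_mul_of_nonneg_right hWd' (Real.log_nonneg hσ1)
  rw [hlq] at hGe
  linarith

end Integrality

section UpperBound

theorem momentFunctional_nodePoly_inv {q a b c m : ℝ} (hq : q ≠ 0) (s n : ℕ) :
    b * q ^ (s + n + 2) * momentFunctional (momentSeq q a b c m)
        (nodePoly (fun l => a * q⁻¹ ^ l) (s + 1) * X ^ n) =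
      momentFunctional (momentSeq q a b c m) (nodePoly (fun l => a * q⁻¹ ^ l) s * X ^ (n + 2)) -
        a * q * momentFunctional (momentSeq q a b c m)
          (nodePoly (fun l => a * q⁻¹ ^ l) s * X ^ (n + 1)) := by
  have h (s n : ℕ) := momentFunctional_nodePoly_succ (momentSeq q a b c m)
    (fun l => a * q⁻¹ ^ l) s n
  induction s generalizing n with
  | zero =>
    rw [h]
    simp only [nodePoly_zero, one_mul, momentFunctional_X_pow, momentSeq_succ]
    ring
  | succ s ih =>
    have hqs : q * q⁻¹ = 1 := mul_inv_cancel₀ hq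
    have h4 : b * q ^ (s + 1 + n + 2) * (a * q⁻¹ ^ (s + 1)) = a * q⁻¹ ^ s * (b * q ^ (s + n + 2)) := by
      linear_combination (a * b * q⁻¹ ^ s * q ^ (s + n + 2)) * hqs
    rw [h (s + 1) n, mul_sub, ← mul_assoc, h4, mul_assoc (a * q⁻¹ ^ s), ih,
      show s + 1 + n + 2 = s + (n + 1) + 2 by ring, ih, h s (n + 2), h s (n + 1)]
    ring

theorem abs_momentFunctional_nodePoly_le {q a b c m T G : ℝ} (hq : 1 < |q|) (hb : 1 ≤ |b|)
    (hG : 1 ≤ G) (haG : |a| ≤ G) (hT : 0 ≤ T) (hw : ∀ n, |momentSeq q a b c m n| ≤ T * |a| ^ n)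
    (s n : ℕ) :
    |q| ^ (s * (s + n)) * |momentFunctional (momentSeq q a b c m)
      (nodePoly (fun l => a * q⁻¹ ^ l) s * X ^ n)| ≤ T * (2 * G ^ 2) ^ s * G ^ n := by
  have hq0 : q ≠ 0 := fun h => by norm_num [h] at hq
  have hr0 : 0 < |q| := by linarith
  have hG0 : 0 < G := by linarith
  induction s generalizing n with
  | zero =>
    simp only [zero_mul, pow_zero, nodePoly_zero, one_mul, momentFunctional_X_pow, mul_one]
    exact (hw n).trans (mul_le_mul_of_nonneg_left (pow_le_pow_left₀ (abs_nonneg _) haG n) hT)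
  | succ s ih =>
    have h1 := congrArg abs (momentFunctional_nodePoly_inv (a := a) (b := b) (c := c) (m := m)
      hq0 s n)
    set U : ℕ → ℕ → ℝ := fun s n => momentFunctional (momentSeq q a b c m)
      (nodePoly (fun l => a * q⁻¹ ^ l) s * X ^ n) with hU
    change |b * q ^ (s + n + 2) * U (s + 1) n| = |U s (n + 2) - a * q * U s (n + 1)| at h1
    change |q| ^ ((s + 1) * (s + 1 + n)) * |U (s + 1) n| ≤ _
    have h2 : |q| ^ (s * (s + (n + 2))) * |U s (n + 2)| ≤ _ := ih (n + 2)
    have h3 : |q| ^ (s * (s + (n + 1))) * |U s (n + 1)| ≤ _ := ih (n + 1)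
    have h4 : |q| ^ (s + n + 2) * |U (s + 1) n| ≤ |U s (n + 2)| + G * |q| * |U s (n + 1)| := by
      calc |q| ^ (s + n + 2) * |U (s + 1) n| ≤ |b| * (|q| ^ (s + n + 2) * |U (s + 1) n|) :=
            le_mul_of_one_le_left (by positivity) hb
        _ = |U s (n + 2) - a * q * U s (n + 1)| := by
            rw [← h1, abs_mul, abs_mul, abs_pow, mul_assoc]
        _ ≤ |U s (n + 2)| + |a| * |q| * |U s (n + 1)| := by
            rw [← abs_mul, ← abs_mul]; exact abs_sub _ _
        _ ≤ _ := by gcongr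
    refine le_of_mul_le_mul_left ?_ hr0
    calc |q| * (|q| ^ ((s + 1) * (s + 1 + n)) * |U (s + 1) n|)
        = |q| ^ (s * (s + (n + 1))) * (|q| ^ (s + n + 2) * |U (s + 1) n|) := by ring
      _ ≤ |q| ^ (s * (s + (n + 1))) * (|U s (n + 2)| + G * |q| * |U s (n + 1)|) := by gcongr
      _ = |q| ^ (s * (s + (n + 1))) * |U s (n + 2)| +
            G * |q| * (|q| ^ (s * (s + (n + 1))) * |U s (n + 1)|) := by ring
      _ ≤ |q| ^ (s * (s + (n + 2))) * |U s (n + 2)| +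
            G * |q| * (T * (2 * G ^ 2) ^ s * G ^ (n + 1)) := by
          gcongr
          · exact hq.le
          · omega
      _ ≤ |q| * (T * (2 * G ^ 2) ^ s * G ^ (n + 2)) +
            G * |q| * (T * (2 * G ^ 2) ^ s * G ^ (n + 1)) := by
          exact add_le_add (h2.trans (le_mul_of_one_le_left (by positivity) hq.le)) le_rfl
      _ = |q| * (T * (2 * G ^ 2) ^ (s + 1) * G ^ n) := by ring

theorem le_sum_perm_add_sq (N : ℕ) (τ : Equiv.Perm (Fin N)) :
    (N : ℝ) * (N - 1) ^ 2 / 2 ≤ ∑ i : Fin N, (τ i : ℝ) * ((τ i : ℝ) + i) := by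
  have h1 : ∀ i : Fin N, (2 * (N - 1) * ((τ i : ℝ) + i) - ((N : ℝ) - 1) ^ 2) / 2 +
      ((τ i : ℝ) ^ 2 - (i : ℝ) ^ 2) / 2 ≤ (τ i : ℝ) * ((τ i : ℝ) + i) := fun i => by
    nlinarith [sq_nonneg ((τ i : ℝ) + i - (N - 1))]
  refine le_trans ?_ (Finset.sum_le_sum fun i _ => h1 i)
  have h2 : ∑ i : Fin N, (τ i : ℝ) = ∑ i : Fin N, (i : ℝ) :=
    Equiv.sum_comp τ fun i : Fin N => (i : ℝ)
  have h3 : ∑ i : Fin N, (τ i : ℝ) ^ 2 = ∑ i : Fin N, (i : ℝ) ^ 2 :=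
    Equiv.sum_comp τ fun i : Fin N => (i : ℝ) ^ 2
  have h4 : ∀ n : ℕ, ∑ i ∈ range n, (i : ℝ) = n * (n - 1) / 2 := fun n => by
    induction n with
    | zero => simp
    | succ n ih => rw [Finset.sum_range_succ, ih]; push_cast; ring
  rw [Finset.sum_add_distrib, ← Finset.sum_div, ← Finset.sum_div, Finset.sum_sub_distrib,
    Finset.sum_sub_distrib, ← Finset.mul_sum, Finset.sum_add_distrib, h2, h3, ← Finset.sum_range fun i => (i : ℝ),
    h4, Finset.sum_const, Finset.card_univ, Fintype.card_fin, nsmul_eq_mul]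
  exact le_of_eq (by ring)

/-- Analytic upper bound for the Hankel determinants. -/
theorem exists_abs_det_hankelMatrix_le {q a b c m T : ℝ} (hq : 1 < |q|) (hb : 1 ≤ |b|)
    (hw : ∀ n, |momentSeq q a b c m n| ≤ T * |a| ^ n) :
    ∃ K : ℝ, ∀ N : ℕ, |(hankelMatrix (momentSeq q a b c m) N).det| ≤
      Real.exp (K * N ^ 2 - Real.log |q| * N ^ 3 / 2) := by
  set G : ℝ := max |a| 1 with hG
  set S : ℝ := max T 1 with hS
  have hG1 : 1 ≤ G := le_max_right _ _
  have hS1 : 1 ≤ S := le_max_right _ _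
  have hlG := Real.log_nonneg hG1
  have hlS := Real.log_nonneg hS1
  have hlq := Real.log_pos hq
  set E : ℝ := 2 * G ^ 2 with hE
  have hE1 : 1 ≤ E := by nlinarith
  have hlE := Real.log_nonneg hE1
  have hr0 : 0 < |q| := by linarith
  have hw' : ∀ n, |momentSeq q a b c m n| ≤ S * |a| ^ n := fun n =>
    (hw n).trans (mul_le_mul_of_nonneg_right (le_max_left _ _) (by positivity))
  set U : ℕ → ℕ → ℝ := fun s n => momentFunctional (momentSeq q a b c m)
    (nodePoly (fun l => a * q⁻¹ ^ l) s * X ^ n) with hU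
  have hUle : ∀ s n, |U s n| ≤ Real.exp (Real.log S + s * Real.log E + n * Real.log G -
      s * (s + n) * Real.log |q|) := fun s n => by
    have h1 := abs_momentFunctional_nodePoly_le hq hb hG1 (le_max_left _ _) (by linarith) hw' s n
    have h2 : Real.exp (Real.log S + s * Real.log E + n * Real.log G -
        s * (s + n) * Real.log |q|) = S * E ^ s * G ^ n / |q| ^ (s * (s + n)) := by
      rw [Real.exp_sub, Real.exp_add, Real.exp_add, Real.exp_log (by linarith),
        Real.exp_nat_mul, Real.exp_log (by linarith), Real.exp_nat_mul, Real.exp_log (by linarith),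
        ← Nat.cast_add, ← Nat.cast_mul, Real.exp_nat_mul, Real.exp_log hr0]
    rw [h2, le_div_iff₀ (by positivity), mul_comm]
    exact h1
  refine ⟨1 + Real.log S + Real.log E + Real.log G + Real.log |q|, fun N => ?_⟩
  rw [← det_momentFunctional_mul _ (nodePoly_monic fun l => a * q⁻¹ ^ l)
    (natDegree_nodePoly _) (Q := fun j => X ^ j) monic_X_pow natDegree_X_pow N, Matrix.det_apply]
  refine (Finset.abs_sum_le_sum_abs _ _).trans ?_
  have hterm : ∀ τ : Equiv.Perm (Fin N), |Equiv.Perm.sign τ • ∏ i, U (τ i) i| ≤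
      Real.exp ((Real.log S + Real.log E + Real.log G + Real.log |q|) * N ^ 2 -
        Real.log |q| * N ^ 3 / 2) := fun τ => by
    have h1 : |Equiv.Perm.sign τ • ∏ i, U (τ i) i| = |∏ i, U (τ i) i| := by
      rcases Int.units_eq_one_or (Equiv.Perm.sign τ) with h | h <;> simp [h]
    rw [h1, Finset.abs_prod]
    refine (Finset.prod_le_prod (fun _ _ => abs_nonneg _) fun i _ => hUle _ _).trans ?_
    rw [← Real.exp_sum]
    refine Real.exp_le_exp.2 ?_
    rw [Finset.sum_sub_distrib, ← Finset.sum_mul]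
    have h2 := mul_le_mul_of_nonneg_right (le_sum_perm_add_sq N τ) hlq.le
    have h3 : ∑ i : Fin N, (Real.log S + (τ i : ℕ) * Real.log E + (i : ℕ) * Real.log G) ≤
        ∑ _i : Fin N, N * (Real.log S + Real.log E + Real.log G) := by
      refine Finset.sum_le_sum fun i _ => ?_
      have h4 : ((τ i : ℕ) : ℝ) ≤ N := by exact_mod_cast (τ i).2.le
      have h5 : ((i : ℕ) : ℝ) ≤ N := by exact_mod_cast i.2.le
      have h6 : (1 : ℝ) ≤ N := by exact_mod_cast (Nat.zero_le _).trans_lt i.2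
      have := mul_le_mul_of_nonneg_right h4 hlE
      have := mul_le_mul_of_nonneg_right h5 hlG
      have := mul_le_mul_of_nonneg_right h6 hlS
      linarith
    rw [Finset.sum_const, Finset.card_univ, Fintype.card_fin, nsmul_eq_mul] at h3
    nlinarith [mul_nonneg (Nat.cast_nonneg (α := ℝ) N) hlq.le]
  refine (Finset.sum_le_sum fun τ _ => hterm τ).trans ?_
  rw [Finset.sum_const, Finset.card_univ, Fintype.card_perm, Fintype.card_fin, nsmul_eq_mul]
  have hfac : ((N.factorial : ℕ) : ℝ) ≤ Real.exp ((N : ℝ) ^ 2) := by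
    have h1 : ((N.factorial : ℕ) : ℝ) ≤ (N : ℝ) ^ N := by exact_mod_cast Nat.factorial_le_pow N
    have h2 : (N : ℝ) ≤ Real.exp N := by linarith [Real.add_one_le_exp (N : ℝ)]
    refine h1.trans ((pow_le_pow_left₀ (Nat.cast_nonneg _) h2 N).trans ?_)
    rw [← Real.exp_nat_mul, sq]
  refine (mul_le_mul_of_nonneg_right hfac (Real.exp_pos _).le).trans ?_
  rw [← Real.exp_add]
  exact Real.exp_le_exp.2 (by linarith)

end UpperBound

section Kronecker

variable {k : Type*} [Field k]

theorem momentFunctional_mul_eq_sum (w : ℕ → k) (A : k[X]) {P : k[X]} {M : ℕ}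
    (hP : P.natDegree < M) :
    momentFunctional w (A * P) = ∑ j ∈ range M, P.coeff j * momentFunctional w (A * X ^ j) := by
  conv_lhs => rw [P.as_sum_range' M hP, Finset.mul_sum, map_sum]
  refine Finset.sum_congr rfl fun j _ => ?_
  rw [← C_mul_X_pow_eq_monomial, mul_left_comm, momentFunctional_C_mul]

theorem exists_orthogonal_of_det_eq_zero {w : ℕ → k} {n : ℕ}
    (h : (hankelMatrix w (n + 1)).det = 0) :
    ∃ B : k[X], B ≠ 0 ∧ B.natDegree ≤ n ∧ ∀ i ≤ n, momentFunctional w (B * X ^ i) = 0 := by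
  obtain ⟨v, hv, hMv⟩ := Matrix.exists_mulVec_eq_zero_iff.2 h
  have hcoeff : ∀ j : Fin (n + 1),
      (∑ i : Fin (n + 1), C (v i) * (X : k[X]) ^ (i : ℕ)).coeff j = v j := fun j => by
    simp [Polynomial.finsetSum_coeff, Polynomial.coeff_C_mul, Polynomial.coeff_X_pow,
      Fin.val_inj, Finset.sum_ite_eq]
  have hdeg : (∑ i : Fin (n + 1), C (v i) * (X : k[X]) ^ (i : ℕ)).natDegree ≤ n :=
    natDegree_sum_le_of_forall_le _ _ fun i _ =>
      (natDegree_C_mul_X_pow_le _ _).trans (Nat.lt_succ_iff.1 i.2)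
  refine ⟨∑ i : Fin (n + 1), C (v i) * X ^ (i : ℕ), fun h0 => hv (funext fun j => ?_), hdeg,
    fun i hi => ?_⟩
  · rw [← hcoeff j, h0, coeff_zero, Pi.zero_apply]
  · rw [momentFunctional_mul_X_pow w (Nat.lt_succ_of_le hdeg), Finset.sum_range]
    have h2 := congrFun hMv ⟨i, Nat.lt_succ_of_le hi⟩
    rw [Pi.zero_apply, Matrix.mulVec, dotProduct] at h2
    rw [← h2]
    refine Finset.sum_congr rfl fun j _ => ?_
    rw [hcoeff, hankelMatrix, Matrix.of_apply, mul_comm, add_comm]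

theorem eq_zero_of_orthogonal {w : ℕ → k} {d : ℕ} (h : (hankelMatrix w d).det ≠ 0) {P : k[X]}
    (hP : P.degree < d) (hort : ∀ i < d, momentFunctional w (P * X ^ i) = 0) : P = 0 := by
  by_contra hP0
  have hPd : P.natDegree < d := (natDegree_lt_iff_degree_lt hP0).2 hP
  refine h (Matrix.exists_mulVec_eq_zero_iff.1 ⟨fun j => P.coeff j, fun hv => hP0 ?_, ?_⟩)
  · ext j
    rcases lt_or_ge j d with hj | hj
    · simpa using congrFun hv ⟨j, hj⟩
    · rw [coeff_eq_zero_of_natDegree_lt (hPd.trans_le hj), coeff_zero]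
  · ext i
    rw [Pi.zero_apply, ← hort i i.2, momentFunctional_mul_X_pow w hPd, Finset.sum_range,
      Matrix.mulVec, dotProduct]
    refine Finset.sum_congr rfl fun j _ => ?_
    rw [hankelMatrix, Matrix.of_apply, mul_comm, add_comm]

/-- Kronecker: if almost all Hankel determinants vanish, the sequence is linearly recurrent. -/
theorem exists_annihilating_polynomial {w : ℕ → k} {N₀ : ℕ}
    (h : ∀ N ≥ N₀, (hankelMatrix w N).det = 0) :
    ∃ A : k[X], A ≠ 0 ∧ ∀ n, momentFunctional w (A * X ^ n) = 0 := by
  classical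
  set d := Nat.findGreatest (fun N => (hankelMatrix w N).det ≠ 0) N₀ with hd
  have hVd : (hankelMatrix w d).det ≠ 0 :=
    Nat.findGreatest_spec (P := fun N => (hankelMatrix w N).det ≠ 0) (Nat.zero_le N₀)
      (by simp [Matrix.det_fin_zero])
  have hV : ∀ N > d, (hankelMatrix w N).det = 0 := fun N hN => by
    rcases le_or_gt N N₀ with h1 | h1
    · exact not_not.1 (Nat.findGreatest_is_greatest (P := fun N => (hankelMatrix w N).det ≠ 0) hN h1)
    · exact h N h1.le
  obtain ⟨B, hB0, hBd, hB⟩ := exists_orthogonal_of_det_eq_zero (hV (d + 1) (Nat.lt_succ_self d))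
  have hBd' : B.natDegree = d := by
    by_contra hne
    exact hB0 (eq_zero_of_orthogonal hVd
      ((natDegree_lt_iff_degree_lt hB0).1 (lt_of_le_of_ne hBd hne)) fun i hi => hB i hi.le)
  set A := B * C B.leadingCoeff⁻¹ with hA
  have hAm : A.Monic := monic_mul_leadingCoeff_inv hB0
  have hAd : A.degree = d := by
    rw [hA, degree_mul_leadingCoeff_inv _ hB0, degree_eq_natDegree hB0, hBd']
  refine ⟨A, hAm.ne_zero, fun n => ?_⟩
  induction n using Nat.strong_induction_on with
  | _ n ih =>
  rcases le_or_gt n d with hn | hn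
  · rw [hA, mul_right_comm, mul_comm, momentFunctional_C_mul, hB n hn, mul_zero]
  have hlow : ∀ P : k[X], P.natDegree < n → momentFunctional w (A * P) = 0 := fun P hP => by
    rw [momentFunctional_mul_eq_sum w A hP]
    exact Finset.sum_eq_zero fun j hj => by rw [ih j (Finset.mem_range.1 hj), mul_zero]
  obtain ⟨F, hF0, hFd, hF⟩ := exists_orthogonal_of_det_eq_zero (hV (n + 1) (by omega))
  have hdiv := modByMonic_add_div F A
  have hAn : A.natDegree = d := natDegree_eq_of_degree_eq_some hAd
  have hQd : (F /ₘ A).natDegree ≤ n - d := by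
    rw [natDegree_divByMonic F hAm, hAn]
    omega
  have hR : F %ₘ A = 0 := by
    refine eq_zero_of_orthogonal hVd (hAd ▸ degree_modByMonic_lt F hAm) fun i hi => ?_
    have h1 : F %ₘ A * X ^ i = F * X ^ i - A * (F /ₘ A * X ^ i) := by
      linear_combination X ^ i * hdiv
    rw [h1, map_sub, hF i (by omega), hlow, sub_zero]
    have := natDegree_mul_le (p := F /ₘ A) (q := X ^ i)
    rw [natDegree_X_pow] at this
    omega
  rw [hR, zero_add] at hdiv
  have hQ0 : F /ₘ A ≠ 0 := fun h0 => hF0 (by rw [← hdiv, h0, mul_zero])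
  set Q := F /ₘ A with hQ
  have h2 := hF (n - Q.natDegree) (Nat.sub_le _ _)
  have h3 : (Q * X ^ (n - Q.natDegree)).natDegree < n + 1 := by
    rw [natDegree_mul_X_pow _ hQ0]
    omega
  rw [← hdiv, mul_assoc, momentFunctional_mul_eq_sum w A h3, Finset.sum_range_succ,
    Finset.sum_eq_zero fun j hj => by rw [ih j (Finset.mem_range.1 hj), mul_zero], zero_add] at h2
  refine (mul_eq_zero.1 h2).resolve_left ?_
  rw [coeff_mul_X_pow', if_pos (Nat.sub_le _ _), Nat.sub_sub_self (by omega)]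
  exact leadingCoeff_ne_zero.2 hQ0

theorem eq_zero_of_hasSum_mul_pow {t : ℝ} (ht0 : t ≠ 0) (ht : |t| < 1) (j : ℕ) :
    ∀ β : ℕ → ℝ, (∀ n : ℕ, HasSum (fun i => β i * (t ^ i) ^ n) 0) → β j = 0 := by
  have hzero : ∀ β : ℕ → ℝ, (∀ n : ℕ, HasSum (fun i => β i * (t ^ i) ^ n) 0) → β 0 = 0 := by
    intro β hβ
    have hs : Summable fun i => |β (i + 1)| := by
      have := (hβ 0).summable.abs
      simp only [pow_zero, mul_one] at this
      exact (summable_nat_add_iff (f := fun i => |β i|) 1).2 this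
    have hle : ∀ n : ℕ, |β 0| ≤ (∑' i, |β (i + 1)|) * |t| ^ n := fun n => by
      have h1 := (hasSum_nat_add_iff' (f := fun i => β i * (t ^ i) ^ n) 1).2 (hβ n)
      simp only [Finset.sum_range_one, pow_zero, one_pow, mul_one, zero_sub] at h1
      have h2 := tsum_of_norm_bounded (f := fun i => β (i + 1) * (t ^ (i + 1)) ^ n)
        (hs.hasSum.mul_right (|t| ^ n)) fun i => by
          rw [Real.norm_eq_abs, abs_mul, abs_pow, abs_pow]
          refine mul_le_mul_of_nonneg_left (pow_le_pow_left₀ (by positivity) ?_ n) (abs_nonneg _)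
          exact pow_le_of_le_one (abs_nonneg _) ht.le (Nat.succ_ne_zero i)
      rwa [h1.tsum_eq, norm_neg, Real.norm_eq_abs] at h2
    have hlim := (tendsto_pow_atTop_nhds_zero_of_lt_one (abs_nonneg t) ht).const_mul
      (∑' i, |β (i + 1)|)
    rw [mul_zero] at hlim
    exact abs_nonpos_iff.1 (ge_of_tendsto' hlim hle)
  induction j with
  | zero => exact hzero
  | succ j ih =>
    intro β hβ
    refine ih (fun i => β (i + 1)) fun n => ?_
    have h1 := (hasSum_nat_add_iff' (f := fun i => β i * (t ^ i) ^ n) 1).2 (hβ n)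
    rw [Finset.sum_range_one, hzero β hβ, zero_mul, sub_zero] at h1
    have h2 := h1.mul_right ((t ^ n)⁻¹)
    rw [zero_mul] at h2
    convert! h2 using 2 with i
    field_simp
    ring

theorem exists_det_hankelMatrix_ne_zero {w γ : ℕ → ℝ} {a t : ℝ} (ha : a ≠ 0) (ht0 : t ≠ 0)
    (ht : |t| < 1) (hγ : ∀ j, γ j ≠ 0) (hw : ∀ n : ℕ, HasSum (fun j => γ j * (a * t ^ j) ^ n) (w n))
    (N₀ : ℕ) : ∃ N ≥ N₀, (hankelMatrix w N).det ≠ 0 := by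
  by_contra! hcon
  obtain ⟨A, hA0, hA⟩ := exists_annihilating_polynomial hcon
  have hsum : ∀ n : ℕ, HasSum (fun j => γ j * A.eval (a * t ^ j) * (t ^ j) ^ n) 0 := fun n => by
    have h1 := hasSum_sum (s := range (A.natDegree + 1)) fun i _ => (hw (i + n)).mul_left (A.coeff i)
    rw [← momentFunctional_mul_X_pow w (Nat.lt_succ_self A.natDegree), hA] at h1
    have h2 := h1.mul_right ((a ^ n)⁻¹)
    rw [zero_mul] at h2
    convert! h2 using 2 with j
    rw [eval_eq_sum_range, Finset.mul_sum, Finset.sum_mul, Finset.sum_mul]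
    refine Finset.sum_congr rfl fun i _ => ?_
    field_simp
    ring
  have hroot : ∀ j, A.eval (a * t ^ j) = 0 := fun j =>
    (mul_eq_zero.1 (eq_zero_of_hasSum_mul_pow ht0 ht j _ hsum)).resolve_left (hγ j)
  refine hA0 (eq_zero_of_infinite_isRoot A (Set.infinite_of_injective_forall_mem
    (f := fun j : ℕ => a * t ^ j) (fun i j hij => ?_) hroot))
  have h1 := congrArg abs (mul_left_cancel₀ ha hij)
  rw [abs_pow, abs_pow] at h1
  exact pow_right_injective₀ (abs_pos.2 ht0) ht.ne h1

end Kronecker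

section Asymptotics

open Filter Topology

theorem two_mul_div_three_eq_sum (t : ℕ) :
    2 * t / 3 = ∑ m ∈ Ioc 0 t, if m % 3 = 1 then 0 else 1 := by
  induction t with
  | zero => simp
  | succ t ih =>
    rw [← Finset.insert_Ioc_right_eq_Ioc_add_one (Nat.zero_le t), Finset.sum_insert (by simp), ← ih]
    split_ifs <;> omega

/-- The exponent of the `d`-th cyclotomic polynomial as a sum of truncated differences. -/
theorem sum_two_mul_div_three (N : ℕ) {d : ℕ} (hd : 0 < d) :
    ∑ i ∈ range N, 2 * (i / d) / 3 =
      ∑ m ∈ Ioc 0 N, (if m % 3 = 1 then 0 else 1) * (N - m * d) := by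
  have h1 : ∀ i ∈ range N, 2 * (i / d) / 3 =
      ∑ m ∈ Ioc 0 N, if m * d ≤ i then (if m % 3 = 1 then 0 else 1) else 0 := fun i hi => by
    rw [two_mul_div_three_eq_sum, ← Finset.sum_filter]
    refine Finset.sum_congr ?_ fun _ _ => rfl
    ext m
    rw [Finset.mem_range] at hi
    simp only [Finset.mem_filter, Finset.mem_Ioc, Nat.le_div_iff_mul_le hd]
    constructor
    · rintro ⟨h0, h1⟩
      exact ⟨⟨h0, ((Nat.le_mul_of_pos_right m hd).trans h1).trans hi.le⟩, h1⟩
    · rintro ⟨⟨h0, -⟩, h1⟩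
      exact ⟨h0, h1⟩
  rw [Finset.sum_congr rfl h1, Finset.sum_comm]
  refine Finset.sum_congr rfl fun m _ => ?_
  rw [← Finset.sum_filter, Finset.sum_const, smul_eq_mul, mul_comm]
  congr 1
  have h2 : (range N).filter (fun i => m * d ≤ i) = Finset.Ico (m * d) N := by
    ext i
    simp [and_comm]
  rw [h2, Nat.card_Ico]

theorem sum_Ioc_divisorsAntidiagonal {F : ℕ → ℕ → ℝ} {N : ℕ} (hF : ∀ k l, N < k * l → F k l = 0) :
    ∑ d ∈ Ioc 0 N, ∑ x ∈ d.divisorsAntidiagonal, F x.1 x.2 =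
      ∑ k ∈ Ioc 0 N, ∑ l ∈ Ioc 0 N, F k l := by
  trans ∑ d ∈ Ioc 0 N, ∑ x ∈ Ioc 0 N ×ˢ Ioc 0 N with x.1 * x.2 = d, F x.1 x.2
  · refine sum_congr rfl fun n hn => ?_
    rw [mem_Ioc] at hn
    rw [Nat.divisorsAntidiagonal_eq_prod_filter_of_le hn.1.ne' hn.2]
  · simp_rw [sum_filter]
    rw [sum_comm, ← Finset.sum_product' (Ioc 0 N) (Ioc 0 N) F]
    refine sum_congr rfl fun x hx => ?_
    rw [Finset.sum_ite_eq]
    split_ifs with h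
    · rfl
    · rw [Finset.mem_product, mem_Ioc, mem_Ioc] at hx
      rw [mem_Ioc, not_and, not_le] at h
      exact (hF _ _ (h (Nat.mul_pos hx.1.1 hx.2.1))).symm

theorem totient_eq_sum_moebius_mul {d : ℕ} (hd : 0 < d) :
    (Nat.totient d : ℝ) =
      ∑ x ∈ d.divisorsAntidiagonal, ((ArithmeticFunction.moebius x.1 : ℤ) : ℝ) * x.2 := by
  refine (ArithmeticFunction.sum_eq_iff_sum_mul_moebius_eq (R := ℝ)
    (f := fun n => (Nat.totient n : ℝ)) (g := fun n => (n : ℝ)).1 (fun n _ => ?_) d hd).symm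
  exact_mod_cast Nat.sum_totient n

/-- The weighted sums occurring after expanding both the totient and the cyclotomic exponents. -/
noncomputable def truncatedSum (N n : ℕ) : ℝ := ∑ l ∈ Ioc 0 N, (l : ℝ) * ((N - n * l : ℕ) : ℝ)

theorem truncatedSum_eq_zero {N n : ℕ} (h : N < n) : truncatedSum N n = 0 :=
  Finset.sum_eq_zero fun l hl => by
    rw [mem_Ioc] at hl
    rw [Nat.sub_eq_zero_of_le (h.le.trans (Nat.le_mul_of_pos_right n hl.1)), Nat.cast_zero, mul_zero]

theorem truncatedSum_nonneg (N n : ℕ) : 0 ≤ truncatedSum N n :=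
  Finset.sum_nonneg fun _ _ => by positivity

theorem truncatedSum_eq_sum_div {N n : ℕ} (hn : 0 < n) :
    truncatedSum N n = ∑ l ∈ Ioc 0 (N / n), (l : ℝ) * ((N : ℝ) - n * l) := by
  have hsub : Ioc 0 (N / n) ⊆ Ioc 0 N := Finset.Ioc_subset_Ioc_right (Nat.div_le_self N n)
  rw [truncatedSum, ← Finset.sum_subset hsub]
  · refine Finset.sum_congr rfl fun l hl => ?_
    rw [mem_Ioc, Nat.le_div_iff_mul_le hn, mul_comm] at hl
    rw [Nat.cast_sub hl.2, Nat.cast_mul]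
  · intro l hl hl'
    rw [mem_Ioc] at hl
    rw [mem_Ioc, not_and, Nat.le_div_iff_mul_le hn, mul_comm, not_le] at hl'
    rw [Nat.sub_eq_zero_of_le (hl' hl.1).le, Nat.cast_zero, mul_zero]

theorem truncatedSum_le {N n : ℕ} (hn : 0 < n) : truncatedSum N n ≤ N ^ 3 / (n : ℝ) ^ 2 := by
  have hn' : (0 : ℝ) < n := by exact_mod_cast hn
  have hdiv : ((N / n : ℕ) : ℝ) ≤ N / n := Nat.cast_div_le
  have h1 : ∀ l ∈ Ioc 0 (N / n), (l : ℝ) * ((N : ℝ) - n * l) ≤ (N : ℝ) / n * N := fun l hl => by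
    rw [mem_Ioc] at hl
    have h2 : (l : ℝ) ≤ N / n := (Nat.cast_le.2 hl.2).trans hdiv
    have h3 : (N : ℝ) - n * l ≤ N := by
      have : (0 : ℝ) ≤ n * l := by positivity
      linarith
    calc (l : ℝ) * ((N : ℝ) - n * l) ≤ l * N := mul_le_mul_of_nonneg_left h3 (by positivity)
      _ ≤ _ := mul_le_mul_of_nonneg_right h2 (by positivity)
  rw [truncatedSum_eq_sum_div hn]
  refine (Finset.sum_le_sum h1).trans ?_
  rw [Finset.sum_const, Nat.card_Ioc, Nat.sub_zero, nsmul_eq_mul]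
  refine (mul_le_mul_of_nonneg_right hdiv (by positivity)).trans (le_of_eq ?_)
  field_simp

theorem tendsto_truncatedSum {n : ℕ} (hn : 0 < n) :
    Tendsto (fun N : ℕ => truncatedSum N n / N ^ 3) atTop (𝓝 (1 / (6 * (n : ℝ) ^ 2))) := by
  have hn' : (n : ℝ) ≠ 0 := by exact_mod_cast hn.ne'
  have hsum : ∀ x y : ℝ, ∀ M : ℕ, ∑ l ∈ Ioc 0 M, (l : ℝ) * (x - y * l) =
      x * (M * (M + 1)) / 2 - y * (M * (M + 1) * (2 * M + 1)) / 6 := fun x y M => by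
    induction M with
    | zero => simp
    | succ M ih =>
      rw [← Finset.insert_Ioc_right_eq_Ioc_add_one (Nat.zero_le M), Finset.sum_insert (by simp), ih]
      push_cast
      ring
  have h1 : Tendsto (fun N : ℕ => ((N / n : ℕ) : ℝ) / N) atTop (𝓝 (1 / n)) := by
    have h2 := (tendsto_nat_floor_mul_div_atTop (R := ℝ) (a := 1 / n) (by positivity)).comp
      tendsto_natCast_atTop_atTop
    refine h2.congr fun N => ?_
    rw [Function.comp_apply, one_div_mul_eq_div, Nat.floor_div_eq_div]
  have h2 : Tendsto (fun N : ℕ => 1 / (N : ℝ)) atTop (𝓝 0) := tendsto_one_div_atTop_nhds_zero_nat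
  have h3 := ((h1.mul (h1.add h2)).div_const 2).sub
    (((h1.mul (h1.add h2)).mul ((h1.const_mul 2).add h2)).const_mul (n : ℝ) |>.div_const 6)
  have h4 : (1 / (n : ℝ) * (1 / n + 0) / 2 - n * (1 / n * (1 / n + 0) * (2 * (1 / n) + 0)) / 6) =
      1 / (6 * (n : ℝ) ^ 2) := by field_simp; ring
  rw [h4] at h3
  refine h3.congr' ?_
  filter_upwards [eventually_gt_atTop 0] with N hN
  have hN' : (N : ℝ) ≠ 0 := by exact_mod_cast hN.ne'
  rw [truncatedSum_eq_sum_div hn, hsum]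
  field_simp

theorem tendsto_sum_sum_truncatedSum {u v : ℕ → ℝ} (hu : ∀ n, |u n| ≤ 1) (hv : ∀ n, |v n| ≤ 1) :
    Tendsto (fun N : ℕ => (∑ m ∈ Ioc 0 N, ∑ k ∈ Ioc 0 N, u m * v k * truncatedSum N (m * k)) /
      (N : ℝ) ^ 3) atTop
      (𝓝 ((∑' m : ℕ, u m / (m : ℝ) ^ 2) * (∑' k : ℕ, v k / (k : ℝ) ^ 2) / 6)) := by
  have hs : Summable fun m : ℕ => 1 / (m : ℝ) ^ 2 := hasSum_zeta_two.summable
  have hnorm : ∀ w : ℕ → ℝ, (∀ n, |w n| ≤ 1) → Summable fun m : ℕ => ‖w m / (m : ℝ) ^ 2‖ :=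
    fun w hw => Summable.of_nonneg_of_le (fun _ => norm_nonneg _) (fun m => by
      rw [norm_div, Real.norm_eq_abs, Real.norm_of_nonneg (by positivity)]
      exact div_le_div_of_nonneg_right (hw m) (by positivity)) hs
  rw [tsum_mul_tsum_of_summable_norm (hnorm u hu) (hnorm v hv), ← tsum_div_const]
  have hbound : Summable fun x : ℕ × ℕ => 1 / (x.1 : ℝ) ^ 2 * (1 / (x.2 : ℝ) ^ 2) :=
    hs.mul_of_nonneg hs (fun _ => by positivity) fun _ => by positivity
  have hdom := tendsto_tsum_of_dominated_convergence (𝓕 := atTop)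
    (f := fun (N : ℕ) (x : ℕ × ℕ) => if 0 < x.1 ∧ 0 < x.2 then
      u x.1 * v x.2 * (truncatedSum N (x.1 * x.2) / (N : ℝ) ^ 3) else 0)
    (g := fun x : ℕ × ℕ => u x.1 / (x.1 : ℝ) ^ 2 * (v x.2 / (x.2 : ℝ) ^ 2) / 6) hbound
    (fun x => ?_) (Eventually.of_forall fun N x => ?_)
  · refine hdom.congr fun N => ?_
    rw [tsum_eq_sum (s := Ioc 0 N ×ˢ Ioc 0 N), Finset.sum_product, Finset.sum_div]
    · refine Finset.sum_congr rfl fun m hm => ?_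
      rw [Finset.sum_div]
      refine Finset.sum_congr rfl fun k hk => ?_
      rw [if_pos ⟨(mem_Ioc.1 hm).1, (mem_Ioc.1 hk).1⟩, mul_div_assoc]
    · intro x hx
      split_ifs with h0
      · rw [truncatedSum_eq_zero, zero_div, mul_zero]
        by_contra hle
        refine hx (Finset.mem_product.2 ⟨mem_Ioc.2 ⟨h0.1, ?_⟩, mem_Ioc.2 ⟨h0.2, ?_⟩⟩)
        · exact (Nat.le_mul_of_pos_right _ h0.2).trans (not_lt.1 hle)
        · exact (Nat.le_mul_of_pos_left _ h0.1).trans (not_lt.1 hle)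
      · rfl
  · split_ifs with h0
    · have h1 := (tendsto_truncatedSum (Nat.mul_pos h0.1 h0.2)).const_mul (u x.1 * v x.2)
      convert! h1 using 2
      have h2 : (x.1 : ℝ) ≠ 0 := by exact_mod_cast h0.1.ne'
      have h3 : (x.2 : ℝ) ≠ 0 := by exact_mod_cast h0.2.ne'
      push_cast
      field_simp
    · rw [not_and_or, not_lt, not_lt, Nat.le_zero, Nat.le_zero] at h0
      have h1 : u x.1 / (x.1 : ℝ) ^ 2 * (v x.2 / (x.2 : ℝ) ^ 2) / 6 = 0 := by
        rcases h0 with h | h <;> simp [h]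
      rw [h1]
      exact tendsto_const_nhds
  · split_ifs with h0
    · rw [norm_mul, norm_mul, Real.norm_eq_abs, Real.norm_eq_abs,
        Real.norm_of_nonneg (div_nonneg (truncatedSum_nonneg _ _) (by positivity))]
      have h1 : truncatedSum N (x.1 * x.2) / (N : ℝ) ^ 3 ≤
          1 / (x.1 : ℝ) ^ 2 * (1 / (x.2 : ℝ) ^ 2) := by
        refine div_le_of_le_mul₀ (by positivity) (by positivity)
          ((truncatedSum_le (Nat.mul_pos h0.1 h0.2)).trans (le_of_eq ?_))
        push_cast
        rw [mul_pow, one_div_mul_one_div, one_div_mul_eq_div]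
      exact (mul_le_of_le_one_left (div_nonneg (truncatedSum_nonneg _ _) (by positivity))
        (mul_le_one₀ (hu _) (abs_nonneg _) (hv _))).trans h1
    · rw [norm_zero]
      positivity

theorem tsum_moebius_div_sq :
    ∑' k : ℕ, ((ArithmeticFunction.moebius k : ℤ) : ℝ) / (k : ℝ) ^ 2 = 6 / Real.pi ^ 2 := by
  have h1 := LSeries_one_mul_Lseries_moebius (s := 2) (by norm_num)
  rw [LSeries_one_eq_riemannZeta (by norm_num), riemannZeta_two, LSeries] at h1
  have h2 : ∀ k : ℕ, LSeries.term (fun n => ((ArithmeticFunction.moebius n : ℤ) : ℂ)) 2 k =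
      ((((ArithmeticFunction.moebius k : ℤ) : ℝ) / (k : ℝ) ^ 2 : ℝ) : ℂ) := fun k => by
    rcases eq_or_ne k 0 with rfl | hk
    · simp
    · rw [LSeries.term_of_ne_zero hk]
      push_cast
      norm_num
  rw [tsum_congr h2, ← Complex.ofReal_tsum] at h1
  have h3 : Real.pi ^ 2 / 6 *
      ∑' k : ℕ, ((ArithmeticFunction.moebius k : ℤ) : ℝ) / (k : ℝ) ^ 2 = 1 := by
    exact_mod_cast h1
  have hpi : Real.pi ≠ 0 := Real.pi_ne_zero
  field_simp at h3 ⊢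
  linarith

end Asymptotics

section Exponents

open Filter Topology

/-- The indicator of the residues other than `1` modulo `3`. -/
def offOneModThree (m : ℕ) : ℝ := if m % 3 = 1 then 0 else 1

theorem abs_offOneModThree_le (m : ℕ) : |offOneModThree m| ≤ 1 := by
  rw [offOneModThree]
  split_ifs <;> simp

theorem sum_exponent_mul_totient (N : ℕ) :
    ∑ d ∈ Ioc 0 N, ((∑ i ∈ range N, 2 * (i / d) / 3 : ℕ) : ℝ) * Nat.totient d =
      ∑ m ∈ Ioc 0 N, ∑ k ∈ Ioc 0 N,
        offOneModThree m * ((ArithmeticFunction.moebius k : ℤ) : ℝ) * truncatedSum N (m * k) := by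
  have h1 : ∀ d ∈ Ioc 0 N, ((∑ i ∈ range N, 2 * (i / d) / 3 : ℕ) : ℝ) * Nat.totient d =
      ∑ x ∈ d.divisorsAntidiagonal,
        (∑ m ∈ Ioc 0 N, offOneModThree m * ((N - m * (x.1 * x.2) : ℕ) : ℝ)) *
          (((ArithmeticFunction.moebius x.1 : ℤ) : ℝ) * x.2) := fun d hd => by
    rw [mem_Ioc] at hd
    rw [sum_two_mul_div_three N hd.1, totient_eq_sum_moebius_mul hd.1, Finset.mul_sum]
    refine Finset.sum_congr rfl fun x hx => ?_
    rw [(Nat.mem_divisorsAntidiagonal.1 hx).1]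
    congr 1
    push_cast [offOneModThree]
    rfl
  rw [Finset.sum_congr rfl h1, sum_Ioc_divisorsAntidiagonal
    (F := fun k l => (∑ m ∈ Ioc 0 N, offOneModThree m * ((N - m * (k * l) : ℕ) : ℝ)) *
          (((ArithmeticFunction.moebius k : ℤ) : ℝ) * l))]
  · simp_rw [Finset.sum_mul, truncatedSum, Finset.mul_sum]
    conv_lhs => enter [2, k]; rw [Finset.sum_comm]
    rw [Finset.sum_comm]
    refine Finset.sum_congr rfl fun m _ => Finset.sum_congr rfl fun k _ =>
      Finset.sum_congr rfl fun l _ => ?_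
    rw [mul_assoc m k l]
    ring
  · intro k l hkl
    refine mul_eq_zero_of_left (Finset.sum_eq_zero fun m hm => ?_) _
    rw [Nat.sub_eq_zero_of_le (hkl.le.trans (Nat.le_mul_of_pos_left _ (mem_Ioc.1 hm).1)),
      Nat.cast_zero, mul_zero]

theorem tendsto_sum_exponent_mul_totient :
    Tendsto (fun N : ℕ => (∑ d ∈ Ioc 0 N,
      ((∑ i ∈ range N, 2 * (i / d) / 3 : ℕ) : ℝ) * Nat.totient d) / (N : ℝ) ^ 3) atTop
      (𝓝 ((∑' m : ℕ, offOneModThree m / (m : ℝ) ^ 2) / Real.pi ^ 2)) := by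
  have h := tendsto_sum_sum_truncatedSum abs_offOneModThree_le
    (v := fun k => ((ArithmeticFunction.moebius k : ℤ) : ℝ)) fun k => by
      exact_mod_cast ArithmeticFunction.abs_moebius_le_one
  simp_rw [sum_exponent_mul_totient]
  convert h using 2
  rw [tsum_moebius_div_sq]
  ring

theorem tendsto_sum_exponent :
    Tendsto (fun N : ℕ => (∑ d ∈ Ioc 0 N,
      ((∑ i ∈ range N, 2 * (i / d) / 3 : ℕ) : ℝ)) / (N : ℝ) ^ 3) atTop (𝓝 0) := by
  have h1 : ∀ N d : ℕ, 0 < d → ((∑ i ∈ range N, 2 * (i / d) / 3 : ℕ) : ℝ) ≤ N ^ 2 * (d : ℝ)⁻¹ :=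
    fun N d _ => by
    have h2 : ∑ i ∈ range N, 2 * (i / d) / 3 ≤ N * (N / d) := by
      refine (Finset.sum_le_card_nsmul _ _ (N / d) fun i hi => ?_).trans (by simp)
      have := Nat.div_le_div_right (c := d) (Finset.mem_range.1 hi).le
      omega
    calc ((∑ i ∈ range N, 2 * (i / d) / 3 : ℕ) : ℝ) ≤ ((N * (N / d) : ℕ) : ℝ) := Nat.cast_le.2 h2
      _ ≤ N * (N / d) := by
        rw [Nat.cast_mul]
        exact mul_le_mul_of_nonneg_left Nat.cast_div_le (Nat.cast_nonneg N)
      _ = _ := by ring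
  have h3 : ∀ N : ℕ, ∑ d ∈ Ioc 0 N, ((∑ i ∈ range N, 2 * (i / d) / 3 : ℕ) : ℝ) ≤
      N ^ 2 * (1 + Real.log N) := fun N => by
    refine (Finset.sum_le_sum fun d hd => h1 N d (mem_Ioc.1 hd).1).trans ?_
    rw [← Finset.mul_sum]
    refine mul_le_mul_of_nonneg_left ?_ (by positivity)
    have := harmonic_le_one_add_log N
    rw [harmonic_eq_sum_Icc] at this
    push_cast at this
    exact this
  have h4 : Tendsto (fun N : ℕ => 1 / (N : ℝ) + Real.log N / N) atTop (𝓝 0) := by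
    simpa using tendsto_one_div_atTop_nhds_zero_nat.add
      (Real.isLittleO_log_id_atTop.tendsto_div_nhds_zero.comp tendsto_natCast_atTop_atTop)
  refine squeeze_zero (fun N => by positivity) (fun N => ?_) h4
  rcases N.eq_zero_or_pos with rfl | hN
  · simp
  · refine (div_le_div_of_nonneg_right (h3 N) (by positivity)).trans (le_of_eq ?_)
    have : (N : ℝ) ≠ 0 := by exact_mod_cast hN.ne'
    field_simp

theorem sum_natDegree_bound_le (N : ℕ) :
    ((∑ i ∈ range N, i * (2 * i + 1) : ℕ) : ℝ) ≤ 2 / 3 * (N : ℝ) ^ 3 := by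
  have h : ((∑ i ∈ range N, i * (2 * i + 1) : ℕ) : ℝ) = N * (N - 1) * (4 * N + 1) / 6 := by
    induction N with
    | zero => simp
    | succ N ih =>
      rw [Finset.sum_range_succ, Nat.cast_add, ih]
      push_cast
      ring
  rw [h]
  have : (0 : ℝ) ≤ N := Nat.cast_nonneg N
  nlinarith [mul_nonneg this this]

theorem sin_two_pi_mul_div_three (n : ℕ) :
    Real.sin (2 * Real.pi * n / 3) =
      √3 * (1 / 2 + (if n % 3 = 0 then 1 / 2 else 0) - offOneModThree n) := by
  have h1 : 2 * Real.pi * n / 3 = 2 * Real.pi * (n % 3 : ℕ) / 3 + (n / 3 : ℕ) * (2 * Real.pi) := by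
    have : (n : ℝ) = ((n % 3 : ℕ) : ℝ) + 3 * ((n / 3 : ℕ) : ℝ) := by
      exact_mod_cast (Nat.mod_add_div n 3).symm
    conv_lhs => rw [this]
    ring
  rw [h1, Real.sin_add_nat_mul_two_pi, offOneModThree]
  have h2 : Real.sin (2 * Real.pi / 3) = √3 / 2 := by
    rw [show 2 * Real.pi / 3 = Real.pi - Real.pi / 3 by ring, Real.sin_pi_sub, Real.sin_pi_div_three]
  have h3 : Real.sin (2 * Real.pi * 2 / 3) = -(√3 / 2) := by
    rw [show 2 * Real.pi * 2 / 3 = Real.pi / 3 + Real.pi by ring, Real.sin_add_pi,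
      Real.sin_pi_div_three]
  have h4 : n % 3 < 3 := Nat.mod_lt _ (by norm_num)
  interval_cases n % 3
  · norm_num
  · norm_num [h2]
    ring
  · norm_num [h3]
    ring

theorem tsum_offOneModThree_div_sq :
    ∑' m : ℕ, offOneModThree m / (m : ℝ) ^ 2 = 5 * Real.pi ^ 2 / 54 -
      (∑' n : ℕ, Real.sin (2 * Real.pi * (n + 1) / 3) / ((n : ℝ) + 1) ^ 2) / √3 := by
  have hz := hasSum_zeta_two
  have h3 : HasSum (fun n : ℕ => (if n % 3 = 0 then 1 else 0) * (1 / (n : ℝ) ^ 2))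
      (1 / 9 * (Real.pi ^ 2 / 6)) := by
    refine (hasSum_iff_hasSum_of_ne_zero_bij (g := fun n : ℕ => 1 / 9 * (1 / (n : ℝ) ^ 2))
      (fun n => 3 * (n : ℕ)) (fun x y h => Subtype.ext (by simpa using h)) ?_ ?_).2 (hz.mul_left _)
    · intro n hn
      rw [Function.mem_support] at hn
      have hn3 : n % 3 = 0 := by
        by_contra h
        simp [h] at hn
      have hn0 : n ≠ 0 := by
        rintro rfl
        simp at hn
      have hd : n / 3 ≠ 0 := by omega
      refine ⟨⟨n / 3, ?_⟩, by simp only; omega⟩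
      rw [Function.mem_support]
      have : ((n / 3 : ℕ) : ℝ) ≠ 0 := by exact_mod_cast hd
      positivity
    · rintro ⟨n, hn⟩
      simp only [Nat.mul_mod_right, if_true]
      push_cast
      ring
  have hs : Summable fun n : ℕ => Real.sin (2 * Real.pi * n / 3) / (n : ℝ) ^ 2 := by
    refine Summable.of_norm_bounded hz.summable fun n => ?_
    rw [norm_div, Real.norm_eq_abs, Real.norm_of_nonneg (by positivity)]
    exact div_le_div_of_nonneg_right (Real.abs_sin_le_one _) (by positivity)
  have hL : HasSum (fun n : ℕ => Real.sin (2 * Real.pi * n / 3) / (n : ℝ) ^ 2)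
      (∑' n : ℕ, Real.sin (2 * Real.pi * (n + 1) / 3) / ((n : ℝ) + 1) ^ 2) := by
    have := hs.hasSum
    rw [hs.tsum_eq_zero_add] at this
    simpa using this
  have hsum := ((hz.mul_left (1 / 2)).add (h3.mul_left (1 / 2))).sub (hL.div_const √3)
  have heq : (fun n : ℕ => offOneModThree n / (n : ℝ) ^ 2) = fun n : ℕ =>
      1 / 2 * (1 / (n : ℝ) ^ 2) + 1 / 2 * ((if n % 3 = 0 then 1 else 0) * (1 / (n : ℝ) ^ 2)) -
        Real.sin (2 * Real.pi * n / 3) / (n : ℝ) ^ 2 / √3 := by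
    funext n
    have : √3 ≠ 0 := by positivity
    rw [sin_two_pi_mul_div_three]
    split_ifs <;> field_simp <;> ring
  rw [heq, hsum.tsum_eq]
  ring

end Exponents

section Series

open Filter Topology

theorem triangle_succ (k : ℕ) : (k + 1) * (k + 1 + 1) / 2 = k * (k + 1) / 2 + (k + 1) := by
  rw [show (k + 1) * (k + 1 + 1) = k * (k + 1) + 2 * (k + 1) by ring,
    Nat.add_mul_div_left _ _ two_pos]

theorem tschakaloff_term_succ {α q : ℝ} (k : ℕ) :
    α ^ (k + 1) / q ^ ((k + 1) * (k + 1 + 1) / 2) =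
      α * q⁻¹ ^ (k + 1) * (α ^ k / q ^ (k * (k + 1) / 2)) := by
  rw [triangle_succ, pow_add q, pow_succ α, inv_pow]
  ring

theorem summable_tschakaloff (α : ℝ) {q : ℝ} (hq : 1 < |q|) :
    Summable fun k : ℕ => α ^ k / q ^ (k * (k + 1) / 2) := by
  have hq0 : q ≠ 0 := by
    rintro rfl
    norm_num at hq
  rcases eq_or_ne α 0 with rfl | hα
  · refine summable_of_ne_finset_zero (s := {0}) fun k hk => ?_
    rw [Finset.mem_singleton] at hk
    rw [zero_pow hk, zero_div]
  refine summable_of_ratio_test_tendsto_lt_one zero_lt_one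
    (Eventually.of_forall fun k => by positivity) ?_
  have h1 : Tendsto (fun k : ℕ => |α| * |q⁻¹| ^ (k + 1)) atTop (𝓝 0) := by
    have := ((tendsto_pow_atTop_nhds_zero_of_lt_one (abs_nonneg q⁻¹)
      (by rw [abs_inv]; exact inv_lt_one_of_one_lt₀ hq)).comp (tendsto_add_atTop_nat 1)).const_mul |α|
    simpa using this
  refine h1.congr fun k => ?_
  rw [tschakaloff_term_succ, norm_mul, mul_div_cancel_right₀, norm_mul, norm_pow,
    Real.norm_eq_abs, Real.norm_eq_abs]
  exact norm_ne_zero_iff.2 (div_ne_zero (pow_ne_zero _ hα) (pow_ne_zero _ hq0))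

theorem hasSum_momentSeq {q a b c m : ℝ} (hq : 1 < |q|) (hb : b ≠ 0)
    (hm : m = c * ∑' k : ℕ, (a / b) ^ k / q ^ (k * (k + 1) / 2)) (n : ℕ) :
    HasSum (fun k : ℕ => c * ((a / b) ^ k / q ^ (k * (k + 1) / 2)) * (a * q⁻¹ ^ k) ^ n)
      (momentSeq q a b c m n) := by
  have hq0 : q ≠ 0 := by
    rintro rfl
    norm_num at hq
  induction n with
  | zero =>
    simp only [pow_zero, mul_one]
    rw [momentSeq, hm]
    exact (summable_tschakaloff _ hq).hasSum.mul_left c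
  | succ n ih =>
    have h1 := ((hasSum_nat_add_iff' 1).2 ih).mul_left (b * q ^ (n + 1))
    rw [momentSeq_succ]
    convert! h1 using 2 with k
    · rw [tschakaloff_term_succ, mul_pow, mul_pow, inv_pow, inv_pow, ← inv_pow, ← inv_pow,
        ← pow_mul, ← pow_mul]
      generalize (a / b) ^ k / q ^ (k * (k + 1) / 2) = τ
      have h2 : q ^ (n + 1) * (q⁻¹ ^ (k + 1) * q⁻¹ ^ ((k + 1) * n)) = q⁻¹ ^ (k * (n + 1)) := by
        rw [← pow_add, show k + 1 + (k + 1) * n = (n + 1) + k * (n + 1) by ring, pow_add q⁻¹,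
          ← mul_assoc, ← mul_pow, mul_inv_cancel₀ hq0, one_pow, one_mul]
      rw [← h2, pow_succ a]
      field_simp
    · simp

theorem abs_momentSeq_le {q a b c m : ℝ} (hq : 1 < |q|) (hb : b ≠ 0)
    (hm : m = c * ∑' k : ℕ, (a / b) ^ k / q ^ (k * (k + 1) / 2)) (n : ℕ) :
    |momentSeq q a b c m n| ≤
      (∑' k : ℕ, |c * ((a / b) ^ k / q ^ (k * (k + 1) / 2))|) * |a| ^ n := by
  have hs := ((summable_tschakaloff (a / b) hq).mul_left c).abs
  rw [← (hasSum_momentSeq hq hb hm n).tsum_eq, ← Real.norm_eq_abs]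
  refine tsum_of_norm_bounded (hs.hasSum.mul_right _) fun k => ?_
  rw [norm_mul, Real.norm_eq_abs, norm_pow, norm_mul, norm_pow, Real.norm_eq_abs, Real.norm_eq_abs]
  refine mul_le_mul_of_nonneg_left (pow_le_pow_left₀ (by positivity)
    (mul_le_of_le_one_right (abs_nonneg a) (pow_le_one₀ (abs_nonneg _) ?_)) n) (abs_nonneg _)
  rw [abs_inv]
  exact inv_le_one_of_one_le₀ hq.le

end Series

section Irrationality

open Filter Topology

/-- Tschakaloff values at `ρ / σ` with `σ > 0`: irrationality in integral form. -/
theorem ne_mul_tschakaloff {ρ σ : ℤ} (hσ : 0 < σ) (hρσ : σ < |ρ|)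
    (hlog : 7 / 6 * Real.log σ <
      (17 / 24 + (∑' m : ℕ, offOneModThree m / (m : ℝ) ^ 2) / Real.pi ^ 2) * Real.log |(ρ : ℝ)|)
    {a b c m : ℤ} (ha : a ≠ 0) (hb : b ≠ 0) (hc : c ≠ 0) :
    (m : ℝ) ≠ c * ∑' k : ℕ, ((a : ℝ) / b) ^ k / ((ρ : ℝ) / σ) ^ (k * (k + 1) / 2) := by
  intro hm
  have hσ' : (0 : ℝ) < σ := by exact_mod_cast hσ
  have hρσ' : (σ : ℝ) < |(ρ : ℝ)| := by exact_mod_cast hρσ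
  have hq : 1 < |(ρ : ℝ) / σ| := by rwa [abs_div, abs_of_pos hσ', one_lt_div hσ']
  have hq0 : (ρ : ℝ) / σ ≠ 0 := by
    intro h
    rw [h] at hq
    norm_num at hq
  have ha' : (a : ℝ) ≠ 0 := by exact_mod_cast ha
  have hb' : (b : ℝ) ≠ 0 := by exact_mod_cast hb
  have hc' : (c : ℝ) ≠ 0 := by exact_mod_cast hc
  have hlogq : Real.log |(ρ : ℝ) / σ| = Real.log |(ρ : ℝ)| - Real.log σ := by
    rw [abs_div, abs_of_pos hσ', Real.log_div (hσ'.trans hρσ').ne' hσ'.ne']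
  have hlogσ : 0 ≤ Real.log σ := Real.log_nonneg (by exact_mod_cast hσ)
  have hlogρ : 0 ≤ Real.log |(ρ : ℝ)| := hlogσ.trans (Real.log_le_log hσ' hρσ'.le)
  obtain ⟨K, hK, hlower⟩ := exists_le_log_abs_eval hσ hρσ
  obtain ⟨K', hupper⟩ := exists_abs_det_hankelMatrix_le hq
    (by exact_mod_cast Int.one_le_abs hb) (abs_momentSeq_le hq hb' hm)
  set e : ℕ → ℕ → ℕ := fun N d => ∑ i ∈ range N, 2 * (i / d) / 3 with he
  have hkey : ∀ N : ℕ, 0 < N →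
      (hankelMatrix (momentSeq ((ρ : ℝ) / σ) a b c m) N).det ≠ 0 →
      (5 / 24 - 1 / (N : ℝ) + (∑ d ∈ Ioc 0 N, (e N d : ℝ) * Nat.totient d) / (N : ℝ) ^ 3) *
        Real.log |(ρ : ℝ)| - 2 / 3 * Real.log σ - K * ((∑ d ∈ Ioc 0 N, (e N d : ℝ)) / (N : ℝ) ^ 3) -
        K' * (1 / N) + (Real.log |(ρ : ℝ)| - Real.log σ) / 2 ≤ 0 := fun N hN hdet => by
    obtain ⟨o, ho, hdvd⟩ := exists_pow_dvd_det_hankelMatrix (X : ℤ[X]) (C a) (C b) (C c) (C m) N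
    have heval : eval ((ρ : ℝ) / σ) ((hankelMatrix (momentSeq (X : ℤ[X]) (C a) (C b) (C c) (C m))
        N).det.map (Int.castRingHom ℝ)) =
        (hankelMatrix (momentSeq ((ρ : ℝ) / σ) a b c m) N).det := by
      have hf : ∀ P : ℤ[X], eval ((ρ : ℝ) / σ) (P.map (Int.castRingHom ℝ)) =
          eval₂RingHom (Int.castRingHom ℝ) ((ρ : ℝ) / σ) P := fun P => by
        rw [eval_map, coe_eval₂RingHom]
      rw [hf, RingHom.map_det]
      congr 1
      ext i j
      simp only [RingHom.mapMatrix_apply, Matrix.map_apply, hankelMatrix, Matrix.of_apply,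
        map_momentSeq]
      simp
    have h1 := hlower _ (Ioc 0 N) o _ (e N) (fun d hd => (mem_Ioc.1 hd).1) hdvd
      (fun d hd => pow_dvd_det_hankelMatrix _ _ _ _ _ (mem_Ioc.1 hd).1 N)
      (natDegree_det_hankelMatrix_le a b c m N) (by rwa [heval])
    rw [heval] at h1
    have h2 := (Real.log_le_log (abs_pos.2 hdet) (hupper N)).trans_eq (Real.log_exp _)
    rw [hlogq] at h2
    have h3 := mul_le_mul_of_nonneg_right (sum_natDegree_bound_le N) hlogσ
    have h4 := mul_le_mul_of_nonneg_right ho hlogρ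
    have hN' : (0 : ℝ) < N := by exact_mod_cast hN
    have h5 : (5 / 24 * (N : ℝ) ^ 3 - N ^ 2 + ∑ d ∈ Ioc 0 N, (e N d : ℝ) * Nat.totient d) *
        Real.log |(ρ : ℝ)| - 2 / 3 * (N : ℝ) ^ 3 * Real.log σ - K * ∑ d ∈ Ioc 0 N, (e N d : ℝ) -
        K' * N ^ 2 + (Real.log |(ρ : ℝ)| - Real.log σ) * N ^ 3 / 2 ≤ 0 := by
      linarith
    refine le_of_eq_of_le ?_ (div_nonpos_of_nonpos_of_nonneg h5 (by positivity : 0 ≤ (N : ℝ) ^ 3))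
    field_simp
  have hone := tendsto_one_div_atTop_nhds_zero_nat (𝕜 := ℝ)
  have hlim := (((((tendsto_const_nhds (x := (5 / 24 : ℝ))).sub hone).add
    tendsto_sum_exponent_mul_totient).mul_const (Real.log |(ρ : ℝ)|)).sub_const
      (2 / 3 * Real.log σ) |>.sub (tendsto_sum_exponent.const_mul K) |>.sub
      (hone.const_mul K')).add_const ((Real.log |(ρ : ℝ)| - Real.log σ) / 2)
  have hpos := hlim.eventually_const_lt (u := 0) (by linarith)
  obtain ⟨N₀, hN₀⟩ := eventually_atTop.1 hpos
  obtain ⟨N, hN, hdet⟩ := exists_det_hankelMatrix_ne_zero ha' (inv_ne_zero hq0)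
    (by rw [abs_inv]; exact inv_lt_one_of_one_lt₀ hq)
    (fun k => mul_ne_zero hc' (div_ne_zero (pow_ne_zero k (div_ne_zero ha' hb'))
      (pow_ne_zero (k * (k + 1) / 2) hq0))) (hasSum_momentSeq hq hb' hm) (N₀ + 1)
  exact (hkey N (by omega) hdet).not_gt (hN₀ N (by omega))

theorem log_lt_of_tschakaloff_bound {L s r : ℝ}
    (hL : L = ∑' n : ℕ, Real.sin (2 * Real.pi * (n + 1) / 3) / ((n : ℝ) + 1) ^ 2)
    (h : r > 252 * Real.pi ^ 2 / (173 * Real.pi ^ 2 - 72 * √3 * L) * s) :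
    7 / 6 * s <
      (17 / 24 + (∑' m : ℕ, offOneModThree m / (m : ℝ) ^ 2) / Real.pi ^ 2) * r := by
  have hS : 0 ≤ ∑' m : ℕ, offOneModThree m / (m : ℝ) ^ 2 := tsum_nonneg fun m =>
    div_nonneg (by rw [offOneModThree]; split_ifs <;> norm_num) (by positivity)
  rw [tsum_offOneModThree_div_sq, ← hL] at hS ⊢
  have hpi : 0 < Real.pi ^ 2 := by positivity
  have h3 : √3 * √3 = 3 := Real.mul_self_sqrt (by norm_num)
  have hsq : (0 : ℝ) < √3 := by positivity
  have hLdiv : L / √3 = √3 * L / 3 := by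
    rw [div_eq_div_iff hsq.ne' (by norm_num)]
    linear_combination (-L) * h3
  rw [hLdiv] at hS ⊢
  have hD : 0 < 173 * Real.pi ^ 2 - 72 * √3 * L := by linarith
  have h5 : 17 / 24 + (5 * Real.pi ^ 2 / 54 - √3 * L / 3) / Real.pi ^ 2 =
      (173 * Real.pi ^ 2 - 72 * √3 * L) / (216 * Real.pi ^ 2) := by
    field_simp
    ring
  rw [h5, div_mul_eq_mul_div _ _ r, lt_div_iff₀ (by positivity)]
  rw [gt_iff_lt, div_mul_eq_mul_div, div_lt_iff₀ hD] at h
  linarith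

end Irrationality

end Prerequisites

theorem stmt_3 (ρ σ : ℤ) (hcop : IsCoprime ρ σ) (hσ : σ ≠ 0) (hρσ : |σ| < |ρ|)
    (q : ℂ) (hq : q = (ρ : ℂ) / (σ : ℂ))
    (α : ℂ) (hα : α ≠ 0)
    (μ : ℂ) (hμ : μ = ∑' n : ℕ, α ^ n / q ^ (n * (n + 1) / 2))
    (L : ℝ) (hL : L = ∑' n : ℕ, Real.sin (2 * Real.pi * (n + 1) / 3) / ((n : ℝ) + 1) ^ 2)
    (hγ : Real.log |(ρ : ℝ)| >
      252 * Real.pi ^ 2 / (173 * Real.pi ^ 2 - 72 * Real.sqrt 3 * L) * Real.log |(σ : ℝ)|) :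
    ¬ ((∃ a : ℚ, α = (a : ℂ)) ∧ (∃ c : ℚ, μ = (c : ℂ))) := by
  rintro ⟨⟨x, rfl⟩, y, rfl⟩
  have hx : x ≠ 0 := by exact_mod_cast hα
  obtain ⟨r, s, hs, hrs, hdiv, hr, hsσ⟩ : ∃ r s : ℤ, 0 < s ∧ s < |r| ∧
      (ρ : ℂ) / (σ : ℂ) = (((r : ℝ) / (s : ℝ) : ℝ) : ℂ) ∧ |(r : ℝ)| = |(ρ : ℝ)| ∧
      (s : ℝ) = |(σ : ℝ)| := by
    rcases hσ.lt_or_gt with h | h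
    · refine ⟨-ρ, -σ, neg_pos.2 h, by rwa [abs_neg, ← abs_of_neg h], ?_, ?_, ?_⟩
      · push_cast
        rw [neg_div_neg_eq]
      · push_cast
        rw [abs_neg]
      · rw [abs_of_neg (by exact_mod_cast h)]
        push_cast
        rfl
    · refine ⟨ρ, σ, h, by rwa [abs_of_pos h] at hρσ, by push_cast; rfl, rfl, ?_⟩
      rw [abs_of_pos (by exact_mod_cast h)]
  rw [← hr, ← hsσ] at hγ
  have hlog := log_lt_of_tschakaloff_bound hL hγ
  refine ne_mul_tschakaloff hs hrs hlog (Rat.num_ne_zero.2 hx) (Nat.cast_ne_zero.2 x.den_nz)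
    (c := y.den) (m := y.num) (Nat.cast_ne_zero.2 y.den_nz) ?_
  have hy : (y : ℝ) = ∑' k : ℕ, (x : ℝ) ^ k / ((r : ℝ) / s) ^ (k * (k + 1) / 2) := by
    rw [← Complex.ofReal_inj, Complex.ofReal_tsum, Complex.ofReal_ratCast, hμ, hq, hdiv]
    push_cast
    rfl
  have hx' : ((x.num : ℝ) / ((x.den : ℤ) : ℝ)) = x := by
    rw [Int.cast_natCast]
    exact_mod_cast x.num_div_den
  rw [hx', ← hy, Int.cast_natCast]
  exact_mod_cast (Rat.den_mul_eq_num y).symm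
end

section
/- Given complex parameters α, λ, μ with λ ≠ 0, define polynomials v_n in the variable q over ℂ by v_0 = μ − 1 and v_n = (q^n − λ)·v_{n−1} − α^n for n ≥ 1, and let V_n = det(v_{i+j})_{0≤i,j≤n−1} be the Hankel determinant, a polynomial in q. Then for every n ≥ 1: the coefficient of q^k in V_n vanishes for every k < binom(n,3) = n(n−1)(n−2)/6, and the coefficient of q^{binom(n,3)} in V_n equals α^{n(n−1)/2}·λ^{n(n−2)/4}·(λ − (λ+α)μ)^{n/2} if n is even, and equals α^{n(n−1)/2}·λ^{(n−1)²/4}·(μ−1)·(λ − (λ+α)μ)^{(n−1)/2} if n is odd. (All the displayed exponents are nonnegative integers.) -/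
open scoped BigOperators
open Polynomial

/-- The shift operator on sequences. -/
noncomputable def seqShift (R : Type*) [CommRing R] : Module.End R (ℕ → R) :=
  LinearMap.funLeft R R Nat.succ

section Shift

variable {R : Type*} [CommRing R]

lemma seqShift_pow_apply (l : ℕ) (u : ℕ → R) (n : ℕ) :
    (seqShift R ^ l) u n = u (l + n) := by
  induction l generalizing n with
  | zero => simp
  | succ l ih =>
    rw [pow_succ', Module.End.mul_apply]
    change (seqShift R ^ l) u (n + 1) = _
    rw [ih]
    congr 1
    ring

lemma det_hankel_eq_det_aeval_seqShift {N : ℕ} (u : ℕ → R) (P : ℕ → R[X])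
    (hdeg : ∀ i, (P i).natDegree = i) (hmonic : ∀ i, (P i).Monic) :
    Matrix.det (Matrix.of fun i j : Fin N => u ((i : ℕ) + (j : ℕ))) =
      Matrix.det (Matrix.of fun i j : Fin N => aeval (seqShift R) (P i) u j) := by
  have h := Matrix.det_matrixOfPolynomials (n := N) (fun i => P i) (fun i => hdeg i)
    (fun i => hmonic i)
  rw [← Matrix.det_transpose] at h
  rw [← one_mul (Matrix.det _), ← h, ← Matrix.det_mul]
  congr 1
  ext i j
  rw [Matrix.mul_apply, Matrix.of_apply,
    aeval_eq_sum_range' (n := N) (by rw [hdeg]; exact i.2), LinearMap.sum_apply,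
    Finset.sum_apply, Finset.sum_range]
  refine Finset.sum_congr rfl fun l _ => ?_
  simp [seqShift_pow_apply]

/-- The quadratic factor with roots `q ^ m * a` and `-(q ^ m * b)`. -/
noncomputable def quadFactor (q a b : R) (m : ℕ) : R[X] :=
  X ^ 2 + C (q ^ m * (b - a)) * X - C (q ^ (2 * m) * (a * b))

/-- Monic polynomials of degree `i` built from the quadratic factors. -/
noncomputable def rowPoly (q a b : R) (i : ℕ) : R[X] :=
  X ^ (i % 2) * ∏ k ∈ Finset.range (i / 2), quadFactor q a b k

lemma aeval_quadFactor (q a b : R) (m : ℕ) (u : ℕ → R) (n : ℕ) :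
    aeval (seqShift R) (quadFactor q a b m) u n =
      u (n + 2) + q ^ m * (b - a) * u (n + 1) - q ^ (2 * m) * (a * b) * u n := by
  have h1 := seqShift_pow_apply 1 u n
  rw [pow_one] at h1
  rw [quadFactor, map_sub (aeval _), map_add (aeval _), map_mul (aeval _), aeval_C, aeval_C,
    map_pow (aeval _), aeval_X]
  simp only [LinearMap.sub_apply, LinearMap.add_apply, Module.End.mul_apply,
    Module.algebraMap_end_apply, Pi.sub_apply, Pi.add_apply, Pi.smul_apply, smul_eq_mul,
    seqShift_pow_apply, h1, add_comm]

lemma quadFactor_monic [Nontrivial R] (q a b : R) (m : ℕ) : (quadFactor q a b m).Monic := by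
  unfold quadFactor
  monicity!

lemma quadFactor_natDegree [Nontrivial R] (q a b : R) (m : ℕ) :
    (quadFactor q a b m).natDegree = 2 := by
  unfold quadFactor
  compute_degree!

lemma rowPoly_monic [Nontrivial R] (q a b : R) (i : ℕ) : (rowPoly q a b i).Monic :=
  (monic_X_pow _).mul (monic_prod_of_monic _ _ fun k _ => quadFactor_monic q a b k)

lemma rowPoly_natDegree [Nontrivial R] (q a b : R) (i : ℕ) :
    (rowPoly q a b i).natDegree = i := by
  rw [rowPoly, (monic_X_pow _).natDegree_mul
    (monic_prod_of_monic _ _ fun k _ => quadFactor_monic q a b k),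
    natDegree_prod_of_monic _ _ fun k _ => quadFactor_monic q a b k]
  simp only [natDegree_X_pow, quadFactor_natDegree, Finset.sum_const, Finset.card_range,
    smul_eq_mul]
  omega

lemma exists_quadFactor_quotient {q a b : R} {v : ℕ → R}
    (hv : ∀ n, v (n + 1) = (q ^ (n + 1) - b) * v n - a ^ (n + 1)) {w : ℕ → R}
    (hw : w ∈ Submodule.span R (Set.range fun j n => v (n + j))) :
    ∃ w' ∈ Submodule.span R (Set.range fun j n => v (n + j)),
      ∀ n, w (n + 2) + (b - a) * w (n + 1) - a * b * w n = q ^ (n + 1) * w' n := by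
  induction hw using Submodule.span_induction with
  | mem x hx =>
    obtain ⟨j, rfl⟩ := hx
    refine ⟨(q ^ (j + 1)) • (fun n => v (n + (j + 1))) - (q ^ j * a) • (fun n => v (n + j)),
      Submodule.sub_mem _
        (Submodule.smul_mem _ _ (Submodule.subset_span ⟨j + 1, rfl⟩))
        (Submodule.smul_mem _ _ (Submodule.subset_span ⟨j, rfl⟩)), fun n => ?_⟩
    have h1 := hv (n + j)
    have h2 := hv (n + j + 1)
    simp only [Pi.sub_apply, Pi.smul_apply, smul_eq_mul]
    rw [show n + 2 + j = n + j + 1 + 1 by ring, show n + 1 + j = n + j + 1 by ring,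
      show n + (j + 1) = n + j + 1 by ring, h2]
    linear_combination -a * h1
  | zero => exact ⟨0, Submodule.zero_mem _, by simp⟩
  | add x y _ _ hx hy =>
    obtain ⟨x', hx', hx⟩ := hx
    obtain ⟨y', hy', hy⟩ := hy
    refine ⟨x' + y', Submodule.add_mem _ hx' hy', fun n => ?_⟩
    simp only [Pi.add_apply]
    linear_combination hx n + hy n
  | smul c x _ hx =>
    obtain ⟨x', hx', hx⟩ := hx
    refine ⟨c • x', Submodule.smul_mem _ _ hx', fun n => ?_⟩
    simp only [Pi.smul_apply, smul_eq_mul]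
    linear_combination c * hx n

lemma exists_aeval_prod_quadFactor {q a b : R} {v : ℕ → R}
    (hv : ∀ n, v (n + 1) = (q ^ (n + 1) - b) * v n - a ^ (n + 1)) (m : ℕ) :
    ∃ w ∈ Submodule.span R (Set.range fun j n => v (n + j)),
      ∀ n, aeval (seqShift R) (∏ k ∈ Finset.range m, quadFactor q a b k) v n =
        q ^ (m ^ 2 + m * n) * ((-a) ^ m * v n + q * w n) := by
  induction m with
  | zero => exact ⟨0, Submodule.zero_mem _, by simp⟩
  | succ m ih =>
    obtain ⟨w, hw, h⟩ := ih
    obtain ⟨w', hw', h'⟩ := exists_quadFactor_quotient hv hw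
    refine ⟨((-a) ^ m) • (fun n => v (n + 1)) + w',
      Submodule.add_mem _ (Submodule.smul_mem _ _ (Submodule.subset_span ⟨1, rfl⟩)) hw',
      fun n => ?_⟩
    rw [Finset.prod_range_succ, mul_comm, map_mul, Module.End.mul_apply, aeval_quadFactor,
      h, h, h]
    have h1 := hv n
    have h2 := hv (n + 1)
    simp only [Pi.add_apply, Pi.smul_apply, smul_eq_mul]
    have e : v (n + 2) + (b - a) * v (n + 1) - a * b * v n =
        q ^ (n + 1) * (q * v (n + 1) - a * v n) := by
      linear_combination h2 - a * h1
    linear_combination (q ^ (m ^ 2 + m * n + 2 * m) * (-a) ^ m) * e +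
      (q ^ (m ^ 2 + m * n + 2 * m) * q) * h' n

lemma exists_aeval_rowPoly {q a b : R} {v : ℕ → R}
    (hv : ∀ n, v (n + 1) = (q ^ (n + 1) - b) * v n - a ^ (n + 1)) :
    ∃ w : ℕ → ℕ → R, ∀ i n, aeval (seqShift R) (rowPoly q a b i) v n =
      q ^ ((i / 2) ^ 2 + i / 2 * (n + i % 2)) *
        ((-a) ^ (i / 2) * v (n + i % 2) + q * w i n) := by
  choose w _ h using exists_aeval_prod_quadFactor hv
  refine ⟨fun i n => w (i / 2) (n + i % 2), fun i n => ?_⟩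
  rw [rowPoly, map_mul, Module.End.mul_apply, map_pow, aeval_X, seqShift_pow_apply,
    add_comm (i % 2) n, h]

/-- The block lower triangular matrix of leading terms: rows and columns are paired into blocks
of size two. -/
def leadMatrix (a : R) (w : ℕ → R) (N : ℕ) : Matrix (Fin N) (Fin N) R :=
  Matrix.of fun i j =>
    if (i : ℕ) / 2 = (j : ℕ) / 2 ∨ (i : ℕ) / 2 = (j : ℕ) / 2 + 1 ∧ (j : ℕ) % 2 = 1 then
      a ^ ((i : ℕ) / 2) * w (N - 1 - j + (i : ℕ) % 2) else 0

lemma det_leadMatrix_two_add (a : R) (w : ℕ → R) (N : ℕ) :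
    (leadMatrix a w (2 + N)).det =
      (w (N + 1) ^ 2 - w N * w (N + 2)) * (a ^ N * (leadMatrix a w N).det) := by
  rw [← Matrix.det_submatrix_equiv_self finSumFinEquiv,
    ← Matrix.fromBlocks_toBlocks ((leadMatrix a w (2 + N)).submatrix _ _)]
  have h12 : ((leadMatrix a w (2 + N)).submatrix finSumFinEquiv finSumFinEquiv).toBlocks₁₂
      = 0 := by
    ext i j
    simp only [Matrix.toBlocks₁₂, leadMatrix, Matrix.of_apply, Matrix.submatrix_apply,
      finSumFinEquiv_apply_left, finSumFinEquiv_apply_right, Fin.val_castAdd, Fin.val_natAdd,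
      Matrix.zero_apply]
    rw [if_neg]
    omega
  have h22 : ((leadMatrix a w (2 + N)).submatrix finSumFinEquiv finSumFinEquiv).toBlocks₂₂
      = a • leadMatrix a w N := by
    ext i j
    simp only [Matrix.toBlocks₂₂, leadMatrix, Matrix.of_apply, Matrix.submatrix_apply,
      finSumFinEquiv_apply_right, Fin.val_natAdd, Matrix.smul_apply, smul_eq_mul, mul_ite,
      mul_zero]
    have e1 : (2 + (i : ℕ)) / 2 = (i : ℕ) / 2 + 1 := by omega
    have e2 : (2 + (j : ℕ)) / 2 = (j : ℕ) / 2 + 1 := by omega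
    have e3 : (2 + (i : ℕ)) % 2 = (i : ℕ) % 2 := by omega
    have e4 : (2 + (j : ℕ)) % 2 = (j : ℕ) % 2 := by omega
    have e5 : 2 + N - 1 - (2 + (j : ℕ)) = N - 1 - j := by omega
    rw [e1, e2, e3, e4, e5, pow_succ', mul_assoc]
    simp only [add_left_inj]
  rw [h12, Matrix.det_fromBlocks_zero₁₂, h22, Matrix.det_smul, Fintype.card_fin,
    Matrix.det_fin_two]
  congr 1
  have e1 : 2 + N - 1 = N + 1 := by omega
  simp [Matrix.toBlocks₁₁, leadMatrix, e1]
  ring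

lemma casorati_eq {a b c : R} {w : ℕ → R} (h0 : w 0 = c - 1)
    (hw : ∀ n, w (n + 1) = -b * w n - a ^ (n + 1)) (n : ℕ) :
    w (n + 1) ^ 2 - w n * w (n + 2) = -((-(a * b)) ^ n * (a * (b - (b + a) * c))) := by
  induction n with
  | zero =>
    rw [hw 1, hw 0, h0]
    ring
  | succ n ih =>
    have h1 : w (n + 2) = -b * w (n + 1) - a ^ (n + 2) := hw (n + 1)
    have h2 : w (n + 3) = -b * w (n + 2) - a ^ (n + 3) := hw (n + 2)
    have e1 : w (n + 2) = (a - b) * w (n + 1) + a * b * w n := by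
      linear_combination h1 - a * hw n
    have e2 : w (n + 3) = (a - b) * w (n + 2) + a * b * w (n + 1) := by
      linear_combination h2 - a * h1
    change w (n + 2) ^ 2 - w (n + 1) * w (n + 3) = _
    linear_combination -(a * b) * ih + w (n + 2) * e1 - w (n + 1) * e2

end Shift

lemma sign_revPerm_succ (n : ℕ) :
    Equiv.Perm.sign (Fin.revPerm : Equiv.Perm (Fin (n + 1))) =
      (-1) ^ n * Equiv.Perm.sign (Fin.revPerm : Equiv.Perm (Fin n)) := by
  have h : finRotate (n + 1) * Fin.revPerm =
      Equiv.Perm.decomposeFin.symm (0, (Fin.revPerm : Equiv.Perm (Fin n))) := by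
    ext i
    refine Fin.cases ?_ (fun i => ?_) i
    · simp
    · simp [Fin.rev_succ]
  have h2 := congrArg Equiv.Perm.sign h
  rw [Equiv.Perm.sign_mul, sign_finRotate, Equiv.Perm.decomposeFin.symm_sign] at h2
  simp only [if_true, one_mul, Nat.succ_eq_add_one, Nat.add_sub_cancel] at h2
  rw [← h2, ← mul_assoc, ← mul_pow]
  simp

lemma sign_revPerm_two_add (n : ℕ) :
    Equiv.Perm.sign (Fin.revPerm : Equiv.Perm (Fin (2 + n))) =
      -Equiv.Perm.sign (Fin.revPerm : Equiv.Perm (Fin n)) := by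
  rw [add_comm, sign_revPerm_succ, sign_revPerm_succ, pow_succ, ← mul_assoc]
  have : ((-1 : ℤˣ) ^ n * -1 * (-1) ^ n) = -1 := by
    rw [mul_right_comm, ← mul_pow]; simp
  rw [this, neg_one_mul]

lemma sum_div_two (N : ℕ) :
    ∑ i ∈ Finset.range N, i / 2 + N / 2 * N = (N / 2) ^ 2 + N.choose 2 := by
  induction N with
  | zero => simp
  | succ N ih =>
    have hc : (N + 1).choose 2 = N + N.choose 2 := by
      rw [Nat.choose_succ_succ' N 1, Nat.choose_one_right]
    rw [Finset.sum_range_succ, hc]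
    obtain ⟨p, rfl | rfl⟩ := Nat.even_or_odd' N
    · have e1 : 2 * p / 2 = p := by omega
      have e2 : (2 * p + 1) / 2 = p := by omega
      rw [e1] at ih
      rw [e1, e2]
      linarith
    · have e1 : (2 * p + 1) / 2 = p := by omega
      have e2 : (2 * p + 1 + 1) / 2 = p + 1 := by omega
      rw [e1] at ih
      rw [e1, e2]
      linarith

lemma sum_div_two_mul (N : ℕ) :
    (∑ i ∈ Finset.range N, i / 2) * (N - 1) =
      ∑ i ∈ Finset.range N, (i / 2) ^ 2 + N.choose 3 := by
  induction N with
  | zero => simp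
  | succ N ih =>
    have hc : (N + 1).choose 3 = N.choose 2 + N.choose 3 := Nat.choose_succ_succ' N 2
    have h := sum_div_two N
    rw [Finset.sum_range_succ, Finset.sum_range_succ, hc, Nat.add_sub_cancel]
    have hN : (∑ i ∈ Finset.range N, i / 2) * N =
        (∑ i ∈ Finset.range N, i / 2) * (N - 1) + ∑ i ∈ Finset.range N, i / 2 := by
      rcases N with _ | N
      · simp
      · rw [Nat.add_sub_cancel]
        ring
    rw [add_mul, hN, ih]
    linarith

/-- The power of `q` left in an entry of the rescaled matrix, in row block `m` and in the column of
parity `e` of block `k`. -/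
def excess (m k e : ℕ) : ℕ :=
  if m ≤ k then (k - m) * (k - m + e) else (m - k) * (m - k - e)

lemma excess_spec {m k e : ℕ} (he : e < 2) :
    m ^ 2 + (k ^ 2 + e * k) = m * (2 * k + e) + excess m k e := by
  unfold excess
  split_ifs with h
  · obtain ⟨t, rfl⟩ := Nat.exists_eq_add_of_le h
    rw [Nat.add_sub_cancel_left]
    ring
  · obtain ⟨t, rfl⟩ := Nat.exists_eq_add_of_lt (not_le.mp h)
    have e1 : k + t + 1 - k = t + 1 := by omega
    rw [e1]
    interval_cases e
    · rw [Nat.sub_zero]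
      ring
    · rw [Nat.add_sub_cancel]
      ring

lemma excess_eq_zero_iff {m k e : ℕ} (he : e < 2) :
    excess m k e = 0 ↔ m = k ∨ m = k + 1 ∧ e = 1 := by
  unfold excess
  split_ifs with h <;> rw [mul_eq_zero] <;> omega

lemma sum_row_exponents (N : ℕ) :
    ∑ i : Fin N, ((i : ℕ) % 2 * ((i : ℕ) / 2) + (i : ℕ) / 2 * (N - 1)) =
      ∑ j : Fin N, (((j : ℕ) / 2) ^ 2 + (j : ℕ) % 2 * ((j : ℕ) / 2)) + N.choose 3 := by
  rw [Fin.sum_univ_eq_sum_range (fun i => i % 2 * (i / 2) + i / 2 * (N - 1)),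
    Fin.sum_univ_eq_sum_range (fun i => (i / 2) ^ 2 + i % 2 * (i / 2)),
    Finset.sum_add_distrib, Finset.sum_add_distrib, ← Finset.sum_mul, sum_div_two_mul]
  ring

lemma exists_det_hankel_eq {a b : ℂ} {v : ℕ → ℂ[X]}
    (hv : ∀ n : ℕ, v (n + 1) = (X ^ (n + 1) - C b) * v n - C (a ^ (n + 1))) (N : ℕ) :
    ∃ p : ℂ[X], p.eval 0 = (leadMatrix (-a) (fun n => (v n).eval 0) N).det ∧
      Matrix.det (Matrix.of fun i j : Fin N => v ((i : ℕ) + (j : ℕ))) =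
        X ^ N.choose 3 *
          (((Equiv.Perm.sign (Fin.revPerm : Equiv.Perm (Fin N)) : ℤ) : ℂ[X]) * p) := by
  have hv' : ∀ n : ℕ, v (n + 1) = (X ^ (n + 1) - C b) * v n - (C a) ^ (n + 1) := by
    intro n
    rw [hv n, C_pow]
  obtain ⟨w, hw⟩ := exists_aeval_rowPoly hv'
  let g : ℕ → ℕ → ℂ[X] := fun i n => (-C a) ^ (i / 2) * v (n + i % 2) + X * w i n
  let A : Matrix (Fin N) (Fin N) ℂ[X] := Matrix.of fun i j =>
    X ^ (((i : ℕ) / 2) ^ 2 + (i : ℕ) / 2 * (N - 1 - j + (i : ℕ) % 2)) * g i (N - 1 - j)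
  let B : Matrix (Fin N) (Fin N) ℂ[X] := Matrix.of fun i j =>
    X ^ excess ((i : ℕ) / 2) ((j : ℕ) / 2) ((j : ℕ) % 2) * g i (N - 1 - j)
  have hVA : Matrix.det (Matrix.of fun i j : Fin N => v ((i : ℕ) + (j : ℕ))) =
      ((Equiv.Perm.sign (Fin.revPerm : Equiv.Perm (Fin N)) : ℤ) : ℂ[X]) * A.det := by
    rw [det_hankel_eq_det_aeval_seqShift v (rowPoly X (C a) (C b)) (rowPoly_natDegree _ _ _)
      (rowPoly_monic _ _ _), ← Matrix.det_permute']
    congr 1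
    ext1 i j
    have e : N - 1 - (N - ((j : ℕ) + 1)) = j := by omega
    simp only [Matrix.of_apply, Matrix.submatrix_apply, hw, A, g, id, Fin.revPerm_apply,
      Fin.val_rev, e]
  have hAB : (∏ j : Fin N, (X : ℂ[X]) ^ (((j : ℕ) / 2) ^ 2 + (j : ℕ) % 2 * ((j : ℕ) / 2))) *
      A.det = (∏ i : Fin N,
        (X : ℂ[X]) ^ ((i : ℕ) % 2 * ((i : ℕ) / 2) + (i : ℕ) / 2 * (N - 1))) * B.det := by
    rw [← Matrix.det_mul_row, ← Matrix.det_mul_column]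
    congr 1
    ext1 i j
    simp only [Matrix.of_apply, A, B]
    rw [← mul_assoc, ← mul_assoc, ← pow_add, ← pow_add]
    congr 2
    have h := excess_spec (m := (i : ℕ) / 2) (k := (j : ℕ) / 2) (Nat.mod_lt (j : ℕ) two_pos)
    rw [Nat.div_add_mod] at h
    obtain ⟨t, ht⟩ : ∃ t, N - 1 = j + t := Nat.exists_eq_add_of_le (by omega)
    rw [ht, Nat.add_sub_cancel_left]
    linarith
  have hA : A.det = X ^ N.choose 3 * B.det := by
    rw [Finset.prod_pow_eq_pow_sum, Finset.prod_pow_eq_pow_sum, sum_row_exponents, pow_add,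
      mul_assoc] at hAB
    exact mul_left_cancel₀ (pow_ne_zero _ X_ne_zero) hAB
  refine ⟨B.det, ?_, ?_⟩
  · rw [← coe_evalRingHom, RingHom.map_det]
    congr 1
    ext1 i j
    simp only [RingHom.mapMatrix_apply, Matrix.map_apply, B, g, leadMatrix, Matrix.of_apply,
      coe_evalRingHom, ← excess_eq_zero_iff (Nat.mod_lt (j : ℕ) two_pos)]
    split_ifs with h
    · simp [h]
    · simp [h]
  · rw [hVA, hA]
    ring

lemma sign_mul_det_leadMatrix_two_add {a b c : ℂ} {w : ℕ → ℂ} (h0 : w 0 = c - 1)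
    (hw : ∀ n, w (n + 1) = -b * w n - a ^ (n + 1)) (N : ℕ) :
    ((Equiv.Perm.sign (Fin.revPerm : Equiv.Perm (Fin (2 + N))) : ℤ) : ℂ) *
        (leadMatrix (-a) w (2 + N)).det =
      a ^ (2 * N + 1) * b ^ N * (b - (b + a) * c) *
        (((Equiv.Perm.sign (Fin.revPerm : Equiv.Perm (Fin N)) : ℤ) : ℂ) *
          (leadMatrix (-a) w N).det) := by
  have e : (-(a * b)) ^ N * (-a) ^ N = a ^ (2 * N) * b ^ N := by
    rw [← mul_pow, pow_mul, ← mul_pow]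
    ring
  rw [det_leadMatrix_two_add, casorati_eq h0 hw, sign_revPerm_two_add]
  push_cast
  linear_combination (a * (b - (b + a) * c) *
    (((Equiv.Perm.sign (Fin.revPerm : Equiv.Perm (Fin N)) : ℤ) : ℂ) *
      (leadMatrix (-a) w N).det)) * e

lemma sign_mul_det_leadMatrix_even {a b c : ℂ} {w : ℕ → ℂ} (h0 : w 0 = c - 1)
    (hw : ∀ n, w (n + 1) = -b * w n - a ^ (n + 1)) (p : ℕ) :
    ((Equiv.Perm.sign (Fin.revPerm : Equiv.Perm (Fin (2 * p))) : ℤ) : ℂ) *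
        (leadMatrix (-a) w (2 * p)).det =
      a ^ (p * (2 * p - 1)) * b ^ (p * (p - 1)) * (b - (b + a) * c) ^ p := by
  induction p with
  | zero =>
    rw [show (Fin.revPerm : Equiv.Perm (Fin (2 * 0))) = 1 by decide]
    simp
  | succ p ih =>
    rw [show 2 * (p + 1) = 2 + 2 * p by ring, sign_mul_det_leadMatrix_two_add h0 hw, ih]
    have e1 : (p + 1) * (2 + 2 * p - 1) = 2 * (2 * p) + 1 + p * (2 * p - 1) := by
      rcases p with _ | p
      · rfl
      · rw [show 2 + 2 * (p + 1) - 1 = 2 * p + 3 by omega,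
          show 2 * (p + 1) - 1 = 2 * p + 1 by omega]
        ring
    have e2 : (p + 1) * (p + 1 - 1) = 2 * p + p * (p - 1) := by
      rcases p with _ | p
      · rfl
      · simp only [Nat.add_sub_cancel]
        ring
    rw [e1, e2]
    ring

lemma sign_mul_det_leadMatrix_odd {a b c : ℂ} {w : ℕ → ℂ} (h0 : w 0 = c - 1)
    (hw : ∀ n, w (n + 1) = -b * w n - a ^ (n + 1)) (p : ℕ) :
    ((Equiv.Perm.sign (Fin.revPerm : Equiv.Perm (Fin (2 * p + 1))) : ℤ) : ℂ) *
        (leadMatrix (-a) w (2 * p + 1)).det =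
      a ^ (p * (2 * p + 1)) * b ^ (p ^ 2) * (c - 1) * (b - (b + a) * c) ^ p := by
  induction p with
  | zero =>
    rw [show (Fin.revPerm : Equiv.Perm (Fin (2 * 0 + 1))) = 1 by decide]
    simp [leadMatrix, h0]
  | succ p ih =>
    rw [show 2 * (p + 1) + 1 = 2 + (2 * p + 1) by ring,
      sign_mul_det_leadMatrix_two_add h0 hw, ih]
    ring

theorem stmt_6 (α lam μ : ℂ) (hlam : lam ≠ 0)
    (v : ℕ → Polynomial ℂ) (hv0 : v 0 = C (μ - 1))
    (hv : ∀ n : ℕ, v (n + 1) = (X ^ (n + 1) - C lam) * v n - C (α ^ (n + 1)))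
    (V : ℕ → Polynomial ℂ)
    (hV : ∀ n : ℕ, V n = Matrix.det (Matrix.of fun i j : Fin n => v ((i : ℕ) + (j : ℕ))))
    (n : ℕ) (hn : 1 ≤ n) :
    (∀ k < n.choose 3, (V n).coeff k = 0) ∧
    (V n).coeff (n.choose 3) =
      (if Even n then
        α ^ (n * (n - 1) / 2) * lam ^ (n * (n - 2) / 4) * (lam - (lam + α) * μ) ^ (n / 2)
      else
        α ^ (n * (n - 1) / 2) * lam ^ ((n - 1) ^ 2 / 4) * (μ - 1) *
          (lam - (lam + α) * μ) ^ ((n - 1) / 2)) := by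
  obtain ⟨p, hp, hVp⟩ := exists_det_hankel_eq hv n
  rw [hV, hVp]
  have h0 : (v 0).eval 0 = μ - 1 := by simp [hv0]
  have hw : ∀ n, (v (n + 1)).eval 0 = -lam * (v n).eval 0 - α ^ (n + 1) := by
    intro n
    simp [hv n]
  refine ⟨fun k hk => by rw [coeff_X_pow_mul', if_neg (not_le.mpr hk)], ?_⟩
  rw [coeff_X_pow_mul', if_pos le_rfl, Nat.sub_self, coeff_zero_eq_eval_zero, eval_mul, hp,
    eval_intCast]
  obtain ⟨m, rfl | rfl⟩ := Nat.even_or_odd' n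
  · rw [if_pos (even_two_mul m), sign_mul_det_leadMatrix_even h0 hw,
      Nat.mul_div_cancel_left m two_pos, mul_assoc 2 m, Nat.mul_div_cancel_left _ two_pos,
      show 2 * m - 2 = 2 * (m - 1) by omega,
      show 2 * m * (2 * (m - 1)) = 4 * (m * (m - 1)) by ring,
      Nat.mul_div_cancel_left _ four_pos]
  · rw [if_neg (Nat.not_even_iff_odd.mpr (odd_two_mul_add_one m)),
      sign_mul_det_leadMatrix_odd h0 hw, Nat.add_sub_cancel,
      Nat.mul_div_cancel_left m two_pos,
      show (2 * m + 1) * (2 * m) = 2 * (m * (2 * m + 1)) by ring,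
      Nat.mul_div_cancel_left _ two_pos,
      show (2 * m) ^ 2 = 4 * m ^ 2 by ring, Nat.mul_div_cancel_left _ four_pos]
end

section
/- Given complex parameters α and μ, define polynomials v_n in the variable q over ℂ by v_0 = μ − 1 and v_n = q^n·v_{n−1} − α^n for n ≥ 1 (the case λ = 0), and let V_n = det(v_{i+j})_{0≤i,j≤n−1} be the Hankel determinant, a polynomial in q. Set e₀(n) = n(n−2)(5n−2)/24 if n is even and e₀(n) = n(n−1)(5n−7)/24 if n is odd. Then for every n ≥ 1: the coefficient of q^k in V_n vanishes for every k < e₀(n), and the coefficient of q^{e₀(n)} in V_n equals (−1)^{n(n+2)/8}·α^{n(5n−2)/8}·μ^{n/2} if n is even, and equals (−1)^{(n−1)(n−3)/8}·α^{(n−1)(5n+1)/8}·K_{(n−1)/2}(α,μ) if n is odd. (All the displayed exponents are nonnegative integers.) -/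
open scoped BigOperators
open Polynomial

/-- The determinant `K_m(α,μ)` of the `(m+1) × (m+1)` matrix whose `(i,j)` entry is
`μ-1` if `j = i`, `μ` if `j = i-1`, `-α^(j-i)` if `j > i`, and `0` if `j < i-1`. -/
noncomputable def Kdet (α μ : ℂ) (m : ℕ) : ℂ :=
  Matrix.det (Matrix.of fun i j : Fin (m + 1) =>
    if (j : ℕ) = (i : ℕ) then μ - 1
    else if (j : ℕ) + 1 = (i : ℕ) then μ
    else if (i : ℕ) < (j : ℕ) then -α ^ ((j : ℕ) - (i : ℕ))
    else 0)

/-- `p` is `X ^ e` times a polynomial with constant coefficient `c`. -/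
def LeadsWith {R : Type*} [CommRing R] (p : R[X]) (e : ℕ) (c : R) : Prop :=
  ∃ s : R[X], p = X ^ e * s ∧ s.coeff 0 = c

namespace LeadsWith

variable {R : Type*} [CommRing R] {p p' : R[X]} {e e' : ℕ} {c c' : R}

theorem zero (p : R[X]) : LeadsWith p 0 (p.coeff 0) := ⟨p, by simp, rfl⟩

theorem X_pow_mul (h : LeadsWith p e c) (k : ℕ) : LeadsWith (X ^ k * p) (k + e) c := by
  obtain ⟨s, rfl, hs⟩ := h
  exact ⟨s, by ring, hs⟩

theorem C_mul (h : LeadsWith p e c) (a : R) : LeadsWith (C a * p) e (a * c) := by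
  obtain ⟨s, rfl, hs⟩ := h
  exact ⟨C a * s, by ring, by simp [hs]⟩

theorem sub (h : LeadsWith p e c) (h' : LeadsWith p' e c') : LeadsWith (p - p') e (c - c') := by
  obtain ⟨s, rfl, hs⟩ := h
  obtain ⟨s', rfl, hs'⟩ := h'
  exact ⟨s - s', by ring, by simp [hs, hs']⟩

theorem of_lt (h : LeadsWith p e' c) (hlt : e < e') : LeadsWith p e 0 := by
  obtain ⟨s, rfl, hs⟩ := h
  obtain ⟨d, rfl⟩ := Nat.exists_eq_add_of_lt hlt
  exact ⟨X ^ (d + 1) * s, by ring, by simp [pow_succ, mul_assoc]⟩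

theorem of_le (h : LeadsWith p e' c) (hle : e ≤ e') : ∃ a, LeadsWith p e a := by
  rcases hle.eq_or_lt with rfl | hlt
  exacts [⟨c, h⟩, ⟨0, h.of_lt hlt⟩]

theorem coeff_of_lt (h : LeadsWith p e c) {k : ℕ} (hk : k < e) : p.coeff k = 0 := by
  obtain ⟨s, rfl, -⟩ := h
  rw [coeff_X_pow_mul', if_neg (by omega)]

theorem coeff_eq (h : LeadsWith p e c) : p.coeff e = c := by
  obtain ⟨s, rfl, hs⟩ := h
  rw [coeff_X_pow_mul', if_pos le_rfl, Nat.sub_self, hs]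

/-- The lowest term of a determinant, after weighting the columns by powers of `X`. -/
theorem det {ι : Type*} [Fintype ι] [DecidableEq ι] {M : Matrix ι ι R[X]} {G : Matrix ι ι R}
    {t a : ι → ℕ} (h : ∀ i k, LeadsWith (X ^ t k * M i k) (t i + a i) (G i k)) :
    LeadsWith M.det (∑ i, a i) G.det := by
  choose Q hQ hG using h
  refine ⟨(Matrix.of Q).det, ?_, ?_⟩
  · have h1 := Matrix.det_mul_row (fun k => (X : R[X]) ^ t k) M
    have h2 := Matrix.det_mul_column (fun i => (X : R[X]) ^ (t i + a i)) (Matrix.of Q)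
    have h3 : (Matrix.of fun i k => (X : R[X]) ^ t k * M i k) =
        Matrix.of fun i k => X ^ (t i + a i) * Matrix.of Q i k := by
      ext1 i k
      exact hQ i k
    rw [h3, h2, Finset.prod_pow_eq_pow_sum, Finset.prod_pow_eq_pow_sum, Finset.sum_add_distrib,
      pow_add, mul_assoc] at h1
    exact ((monic_X_pow (∑ i, t i)).isRegular.left h1).symm
  · rw [← constantCoeff_apply, RingHom.map_det]
    congr 1
    ext i k
    exact hG i k

end LeadsWith

section

variable {R : Type*} [CommRing R]

/-- Row `i` is obtained from row `0`, the sequence `μ, v 0, v 1, …`, by applying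
`∏ m < i, (E - α X ^ m)`, where `E` is the shift. -/
noncomputable def hankelRow (α μ : R) : ℕ → ℕ → R[X]
  | 0, 0 => C μ
  | 0, j + 1 => X ^ j * hankelRow α μ 0 j - C (α ^ j)
  | i + 1, j => hankelRow α μ i (j + 1) - C α * X ^ i * hankelRow α μ i j

theorem hankelRow_succ (α μ : R) (i j : ℕ) :
    hankelRow α μ (i + 1) j = hankelRow α μ i (j + 1) - C α * X ^ i * hankelRow α μ i j := by
  rw [hankelRow]

theorem hankelRow_succ_succ (α μ : R) (i j : ℕ) :
    hankelRow α μ (i + 1) (j + 1) =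
      X ^ (i + j) * (X * hankelRow α μ i (j + 1) - C α * hankelRow α μ i j) := by
  induction i generalizing j with
  | zero =>
    simp only [hankelRow, map_pow]
    ring
  | succ i ih =>
    rw [hankelRow_succ α μ (i + 1)]
    linear_combination ih (j + 1) - C α * X ^ (i + 1) * ih j
      - X ^ (i + j + 2) * hankelRow_succ α μ i (j + 1)
      + X ^ (i + j + 1) * C α * hankelRow_succ α μ i j

theorem leadsWith_hankelRow_upper (α μ : R) (i j : ℕ) :
    ∃ c, LeadsWith (hankelRow α μ i (j + 1)) (i * j) c ∧ (i < j → c = -((-1) ^ i * α ^ j)) := by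
  induction i generalizing j with
  | zero =>
    refine ⟨_, by simpa using LeadsWith.zero _, fun hj => ?_⟩
    obtain ⟨j, rfl⟩ := Nat.exists_eq_succ_of_ne_zero hj.ne'
    rw [hankelRow]
    simp [coeff_zero_eq_eval_zero]
  | succ i ih =>
    cases j with
    | zero => exact ⟨_, by simpa using LeadsWith.zero _, by simp⟩
    | succ j =>
      obtain ⟨c, hc, -⟩ := ih (j + 1)
      obtain ⟨c', hc', h'⟩ := ih j
      refine ⟨0 - α * c', ?_, fun hlt => ?_⟩
      · rw [hankelRow_succ_succ, mul_sub]
        have h1 := (hc.X_pow_mul 1).X_pow_mul (i + (j + 1))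
        rw [pow_one] at h1
        have h2 := (hc'.C_mul α).X_pow_mul (i + (j + 1))
        rw [show i + (j + 1) + i * j = (i + 1) * (j + 1) by ring] at h2
        exact (h1.of_lt (by lia)).sub h2
      · rw [h' (by omega)]
        ring

theorem sq_div_four_add (t : ℕ) : (t + 2 - 1) ^ 2 / 4 = t + (t - 1) ^ 2 / 4 := by
  cases t with
  | zero => rfl
  | succ t =>
    rw [show (t + 1 + 2 - 1) ^ 2 = (t + 1 - 1) ^ 2 + (t + 1) * 4 by
      simp only [Nat.add_sub_cancel]; rw [show t + 1 + 2 - 1 = t + 2 by omega]; ring]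
    omega

theorem leadsWith_hankelRow_lower (α μ : R) (i j : ℕ) (hj : j ≤ i + 1) :
    LeadsWith (hankelRow α μ i j) ((i + j - 1) ^ 2 / 4)
      ((-α) ^ ((i + j) / 2) *
        if j = i + 1 then μ - 1 else if Even (i + j) then μ else μ - 1 - α * μ) := by
  have mono (t : ℕ) : (t - 1) ^ 2 / 4 ≤ (t + 1 - 1) ^ 2 / 4 :=
    Nat.div_le_div_right (Nat.pow_le_pow_left (by omega) 2)
  induction i generalizing j with
  | zero =>
    have := LeadsWith.zero (hankelRow α μ 0 j)
    interval_cases j <;> simpa [hankelRow] using this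
  | succ i ih =>
    cases j with
    | zero =>
      rw [hankelRow_succ]
      rcases Nat.eq_zero_or_pos i with rfl | hi
      · have := LeadsWith.zero (hankelRow α μ 0 1 - C α * X ^ 0 * hankelRow α μ 0 0)
        simpa [hankelRow] using this
      · have h1 := ih 1 (by omega)
        have h2 := ((ih 0 (by omega)).C_mul α).X_pow_mul i
        rw [mul_left_comm, ← mul_assoc] at h2
        have h3 := sq_div_four_add i
        have h4 : (i + 1 - 1) ^ 2 / 4 < (i + 2 - 1) ^ 2 / 4 := by
          obtain ⟨i, rfl⟩ := Nat.exists_eq_succ_of_ne_zero hi.ne'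
          rw [sq_div_four_add]
          cases i with
          | zero => simp
          | succ i =>
            have := sq_div_four_add i
            have := mono i
            grind
        have := h1.sub (h2.of_lt (e := (i + 1 - 1) ^ 2 / 4) (h3 ▸ h4))
        have hne : i ≠ 0 := by omega
        simpa [hne, hne.symm] using this
    | succ j =>
      rw [hankelRow_succ_succ, mul_sub, show i + 1 + (j + 1) = i + j + 2 by ring, sq_div_four_add]
      have h1 := ((ih j (by omega)).C_mul α).X_pow_mul (i + j)
      have h2 : ∃ c, LeadsWith (hankelRow α μ i (j + 1)) ((i + (j + 1) - 1) ^ 2 / 4) c := by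
        rcases (show j + 1 ≤ i + 1 ∨ j = i + 1 by omega) with h | rfl
        · exact ⟨_, ih _ h⟩
        · obtain ⟨c, hc, -⟩ := leadsWith_hankelRow_upper α μ i (i + 1)
          refine ⟨c, ?_⟩
          convert hc using 1
          rw [show i + (i + 1 + 1) - 1 = 2 * i + 1 by omega,
            show (2 * i + 1) ^ 2 = 1 + i * (i + 1) * 4 by ring]
          omega
      obtain ⟨c, hc⟩ := h2
      have h3 := (hc.X_pow_mul 1).X_pow_mul (i + j)
      rw [pow_one] at h3
      have := mono (i + j)
      have := (h3.of_lt (e := i + j + (i + j - 1) ^ 2 / 4) (by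
        rw [← add_assoc i j 1]; omega)).sub h1
      convert this using 1
      rw [show (i + j + 2) / 2 = (i + j) / 2 + 1 by omega]
      simp only [Nat.add_right_cancel_iff, Nat.even_add_one, Nat.even_add, not_not]
      ring

/-- The coefficient of `E ^ k` in `∏ m < i, (E - α X ^ m)`. -/
noncomputable def rowCoeff (α : R) : ℕ → ℕ → R[X]
  | 0, 0 => 1
  | 0, _ + 1 => 0
  | i + 1, 0 => -(C α * X ^ i * rowCoeff α i 0)
  | i + 1, k + 1 => rowCoeff α i k - C α * X ^ i * rowCoeff α i (k + 1)

theorem rowCoeff_eq_zero (α : R) {i k : ℕ} (h : i < k) : rowCoeff α i k = 0 := by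
  induction i generalizing k with
  | zero =>
    obtain ⟨k, rfl⟩ := Nat.exists_eq_succ_of_ne_zero h.ne'
    rw [rowCoeff]
  | succ i ih =>
    obtain ⟨k, rfl⟩ := Nat.exists_eq_succ_of_ne_zero (Nat.ne_zero_of_lt h)
    rw [rowCoeff, ih (by omega), ih (by omega)]
    simp

theorem rowCoeff_self (α : R) (i : ℕ) : rowCoeff α i i = 1 := by
  induction i with
  | zero => rw [rowCoeff]
  | succ i ih => simp [rowCoeff, ih, rowCoeff_eq_zero]

theorem hankelRow_eq_sum (α μ : R) {i n : ℕ} (h : i < n) (j : ℕ) :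
    hankelRow α μ i j = ∑ k ∈ Finset.range n, rowCoeff α i k * hankelRow α μ 0 (k + j) := by
  induction i generalizing n j with
  | zero =>
    rw [Finset.sum_eq_single_of_mem 0 (Finset.mem_range.2 h)]
    · simp [rowCoeff]
    · intro k _ hk
      rw [rowCoeff_eq_zero α (Nat.pos_of_ne_zero hk), zero_mul]
  | succ i ih =>
    obtain ⟨n, rfl⟩ := Nat.exists_eq_succ_of_ne_zero (Nat.ne_zero_of_lt h)
    have h1 := ih (n := n) (by omega) (j + 1)
    have h2 := ih (n := n + 1) (by omega) j
    rw [Finset.sum_range_succ'] at h2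
    rw [hankelRow_succ, h1, h2, Finset.sum_range_succ']
    simp only [rowCoeff, sub_mul, Finset.sum_sub_distrib, mul_assoc, ← Finset.mul_sum,
      show ∀ k, k + 1 + j = k + (j + 1) from fun k => by ring]
    ring

theorem det_hankel_eq_det_hankelRow (α μ : R) (n : ℕ) :
    (Matrix.of fun i j : Fin n => hankelRow α μ 0 (i + j + 1)).det =
      (Matrix.of fun i j : Fin n => hankelRow α μ i (j + 1)).det := by
  have h : (Matrix.of fun i j : Fin n => hankelRow α μ i (j + 1)) =
      (Matrix.of fun i k : Fin n => rowCoeff α i k) *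
        Matrix.of fun i j : Fin n => hankelRow α μ 0 (i + j + 1) := by
    ext1 i j
    simp only [Matrix.of_apply, Matrix.mul_apply]
    rw [hankelRow_eq_sum α μ i.2, Finset.sum_range]
    rfl
  have h' : (Matrix.of fun i k : Fin n => rowCoeff α i k).det = 1 := by
    rw [Matrix.det_of_isLowerTriangular]
    swap
    · exact fun i k hik => rowCoeff_eq_zero α hik
    simp [rowCoeff_self]
  rw [h, Matrix.det_mul, h', one_mul]

theorem sign_revPerm (n : ℕ) :
    Equiv.Perm.sign (Fin.revPerm : Equiv.Perm (Fin n)) = (-1) ^ (n * (n - 1) / 2) := by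
  have h (j : Fin n) : ∏ i ∈ Finset.Iio j,
      (if Fin.revPerm i < Fin.revPerm j then (1 : ℤˣ) else -1) = (-1) ^ (j : ℕ) := by
    rw [Finset.prod_congr rfl fun i hi => if_neg ?_, Finset.prod_const, Fin.card_Iio]
    simpa using (Finset.mem_Iio.1 hi).le
  rw [Equiv.Perm.sign_eq_prod_prod_Iio, Finset.prod_congr rfl fun j _ => h j,
    Finset.prod_pow_eq_pow_sum, ← Finset.sum_range (fun j => j), Finset.sum_range_id]

theorem det_eq_det_rev {S : Type*} [CommRing S] (F : ℕ → ℕ → S) (n : ℕ) :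
    (Matrix.of fun i j : Fin n => F i (j + 1)).det =
      (-1) ^ (n * (n - 1) / 2) * (Matrix.of fun i k : Fin n => F i (n - k)).det := by
  have h := Matrix.det_permute' Fin.revPerm (Matrix.of fun i k : Fin n => F i (n - k))
  rw [sign_revPerm] at h
  convert h using 2
  · ext i j
    simp only [Matrix.submatrix_apply, Matrix.of_apply, Fin.revPerm_apply, Fin.val_rev, id]
    congr 1
    omega
  · simp

theorem det_of_zero_right {S : Type*} [CommRing S] (n m k : ℕ) (hn : n = m + k) (G : ℕ → ℕ → S)
    (hG : ∀ i < m, ∀ j < n, i < j → G i j = 0) :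
    (Matrix.of fun i j : Fin n => G i j).det =
      (∏ i ∈ Finset.range m, G i i) *
        (Matrix.of fun i j : Fin k => G (m + i) (m + j)).det := by
  induction m generalizing n G with
  | zero =>
    obtain rfl : n = k := by omega
    simp
  | succ m ih =>
    obtain rfl : n = m + k + 1 := by omega
    have h0 (j : Fin (m + k + 1)) (hj : j ≠ 0) : G 0 j = 0 :=
      hG 0 (by omega) _ j.2 (Nat.pos_of_ne_zero fun h => hj (Fin.ext h))
    have h1 := ih (m + k) rfl (fun i j => G (i + 1) (j + 1))
      fun i hi j hj hij => hG _ (by omega) _ (by omega) (by omega)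
    have h2 : ((Matrix.of fun i j : Fin (m + k + 1) => G i j).submatrix Fin.succ
        (Fin.succAbove 0)) = Matrix.of fun i j : Fin (m + k) => G (i + 1) (j + 1) := by
      ext i j
      simp
    rw [Matrix.det_succ_row_zero, Fintype.sum_eq_single 0, h2, h1, Finset.prod_range_succ']
    · simp only [Fin.val_zero, pow_zero, one_mul, Matrix.of_apply, add_right_comm m _ 1]
      ring
    · intro j hj
      rw [Matrix.of_apply, Fin.val_zero, h0 j hj, mul_zero, zero_mul]

/-- `∑ l ∈ {1, …, k}, min l ρ`. -/
def minSum (ρ k : ℕ) : ℕ := ∑ l ∈ Finset.range k, min (l + 1) ρ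

theorem minSum_succ (ρ k : ℕ) : minSum ρ (k + 1) = minSum ρ k + min (k + 1) ρ :=
  Finset.sum_range_succ _ _

theorem minSum_add (ρ b : ℕ) : minSum ρ (ρ + b) = minSum ρ ρ + ρ * b := by
  induction b with
  | zero => simp
  | succ b ih => rw [← add_assoc, minSum_succ, ih, min_eq_right (by omega)]; ring

theorem minSum_add_le (ρ k d : ℕ) : minSum ρ (k + d) ≤ minSum ρ k + (k + d) * d := by
  induction d with
  | zero => simp
  | succ d ih =>
    rw [← add_assoc, minSum_succ]
    have := min_le_left (k + d + 1) ρ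
    nlinarith

theorem le_minSum_add {ρ i : ℕ} (hi : i < ρ) (d : ℕ) :
    minSum ρ i + (i + 1) * d ≤ minSum ρ (i + d) := by
  induction d with
  | zero => simp
  | succ d ih =>
    rw [← add_assoc, minSum_succ]
    have : i + 1 ≤ min (i + d + 1) ρ := by omega
    nlinarith

theorem leadsWith_upper_row (α μ : R) {n ρ i k : ℕ} (hn : 2 * ρ ≤ n) (hi : i < ρ) (hk : k < n) :
    ∃ c, LeadsWith (X ^ minSum ρ k * hankelRow α μ i (n - k)) (minSum ρ i + i * (n - 1 - i)) c ∧
      (k = i → c = -((-1) ^ i * α ^ (n - 1 - i))) ∧ (i < k → c = 0) := by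
  obtain ⟨j, rfl⟩ : ∃ j, n = k + j + 1 := ⟨n - 1 - k, by omega⟩
  obtain ⟨c, hc, h⟩ := leadsWith_hankelRow_upper α μ i j
  rw [show k + j + 1 - k = j + 1 by omega]
  have hc' := hc.X_pow_mul (minSum ρ k)
  rcases lt_trichotomy k i with hki | rfl | hik
  · obtain ⟨d, rfl⟩ := Nat.exists_eq_add_of_le hki.le
    have := minSum_add_le ρ k d
    rw [show k + j + 1 - 1 - (k + d) = j - d by omega]
    obtain ⟨j, rfl⟩ : ∃ l, j = l + d := ⟨j - d, by omega⟩
    obtain ⟨a, ha⟩ := hc'.of_le (e := minSum ρ (k + d) + (k + d) * (j + d - d)) (by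
      rw [Nat.add_sub_cancel]; nlinarith)
    exact ⟨a, ha, by omega, by omega⟩
  · rw [show k + j + 1 - 1 - k = j by omega]
    exact ⟨c, hc', fun _ => h (by omega), by omega⟩
  · obtain ⟨d, rfl⟩ := Nat.exists_eq_add_of_le hik.le
    have := le_minSum_add hi d
    refine ⟨0, hc'.of_lt ?_, by omega, fun _ => rfl⟩
    rw [show i + d + j + 1 - 1 - i = d + j by omega]
    nlinarith

theorem leadsWith_lower_left (α μ : R) {n ρ i k : ℕ} (hn : 2 * ρ ≤ n) (hi : ρ ≤ i) (hk : k < ρ) :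
    ∃ c, LeadsWith (X ^ minSum ρ k * hankelRow α μ i (n - k))
      (minSum ρ i + ρ * (n - 1 - ρ)) c := by
  obtain ⟨d, rfl⟩ := Nat.exists_eq_add_of_lt hk
  obtain ⟨a, rfl⟩ := Nat.exists_eq_add_of_le hi
  obtain ⟨j, rfl⟩ : ∃ j, n = 2 * (k + d + 1) + j := ⟨_, (Nat.add_sub_of_le hn).symm⟩
  obtain ⟨c, hc, -⟩ := leadsWith_hankelRow_upper α μ (k + d + 1 + a) (k + 2 * d + 1 + j)
  rw [show 2 * (k + d + 1) + j - k = k + 2 * d + 1 + j + 1 by omega,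
    show 2 * (k + d + 1) + j - 1 - (k + d + 1) = k + d + j by omega]
  refine (hc.X_pow_mul _).of_le ?_
  rw [minSum_add]
  have := minSum_add_le (k + d + 1) k (d + 1)
  rw [← add_assoc] at this
  nlinarith [Nat.zero_le (a * d), Nat.zero_le (a * j)]

theorem leadsWith_lower_right_even (α μ : R) {ρ a b : ℕ} (hb : b < ρ) :
    ∃ c, LeadsWith (X ^ minSum ρ (ρ + b) * hankelRow α μ (ρ + a) (ρ - b))
      (minSum ρ (ρ + a) + ρ * (ρ - 1)) c ∧
      (a = b → c = (-α) ^ ρ * μ) ∧ (a < b → c = 0) := by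
  have h := (leadsWith_hankelRow_lower α μ (ρ + a) (ρ - b) (by omega)).X_pow_mul
    (minSum ρ (ρ + b))
  rw [minSum_add] at h ⊢
  rw [minSum_add]
  rcases lt_trichotomy a b with hab | rfl | hba
  · obtain ⟨d, rfl⟩ := Nat.exists_eq_add_of_lt hab
    obtain ⟨l, rfl⟩ := Nat.exists_eq_add_of_lt hb
    refine ⟨0, h.of_lt ?_, by omega, fun _ => rfl⟩
    generalize minSum _ _ = M
    rw [show a + d + 1 + l + 1 + a + (a + d + 1 + l + 1 - (a + d + 1)) - 1 =
      2 * a + d + 1 + 2 * l + 1 by omega]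
    have : (a + d + 1 + l + 1) * l + a * (a + d + 1 + l + 1) + 1 ≤
        (2 * a + d + 1 + 2 * l + 1) ^ 2 / 4 := by
      rw [Nat.le_div_iff_mul_le (by norm_num)]
      nlinarith
    rw [Nat.add_sub_cancel]
    nlinarith
  · refine ⟨(-α) ^ ρ * μ, ?_, fun _ => rfl, by omega⟩
    rw [if_neg (by omega), show ρ + a + (ρ - a) = 2 * ρ by omega, if_pos (even_two_mul ρ),
      Nat.mul_div_cancel_left _ two_pos] at h
    convert h using 2
    · obtain ⟨l, rfl⟩ := Nat.exists_eq_add_of_lt hb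
      rw [show 2 * (a + l + 1) - 1 = 2 * (a + l) + 1 by omega,
        show (2 * (a + l) + 1) ^ 2 = 1 + (a + l + 1) * (a + l) * 4 by ring, Nat.add_sub_cancel]
      omega
  · obtain ⟨d, rfl⟩ := Nat.exists_eq_add_of_lt hba
    obtain ⟨l, rfl⟩ := Nat.exists_eq_add_of_lt hb
    obtain ⟨c, hc⟩ := h.of_le (e := minSum (b + l + 1) (b + l + 1) +
        (b + l + 1) * (b + d + 1) + (b + l + 1) * (b + l + 1 - 1)) (by
      generalize minSum _ _ = M
      rw [show b + l + 1 + (b + d + 1) + (b + l + 1 - b) - 1 = 2 * b + 2 * l + d + 2 by omega]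
      have : (b + l + 1) * (d + 1) + (b + l + 1) * (b + l) ≤
          (2 * b + 2 * l + d + 2) ^ 2 / 4 := by
        rw [Nat.le_div_iff_mul_le (by norm_num)]
        nlinarith
      rw [Nat.add_sub_cancel]
      nlinarith)
    exact ⟨c, hc, by omega, by omega⟩

/-- The entries of a tridiagonal matrix with determinant `K_m(α, μ)`. -/
def tridiag (α μ : R) (a b : ℕ) : R :=
  if a = b then (if b = 0 then μ - 1 else μ - 1 - α * μ)
  else if a = b + 1 then -(α * μ) else if b = a + 1 then μ else 0

theorem leadsWith_lower_right_odd (α μ : R) {ρ a b : ℕ} (hb : b ≤ ρ) :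
    LeadsWith (X ^ minSum ρ (ρ + b) * hankelRow α μ (ρ + a) (ρ + 1 - b))
      (minSum ρ (ρ + a) + ρ * ρ) ((-α) ^ ρ * tridiag α μ a b) := by
  have h := (leadsWith_hankelRow_lower α μ (ρ + a) (ρ + 1 - b) (by omega)).X_pow_mul
    (minSum ρ (ρ + b))
  rw [minSum_add] at h ⊢
  rw [minSum_add]
  obtain ⟨l, rfl⟩ := Nat.exists_eq_add_of_le hb
  generalize minSum _ _ = M at *
  have key : (∃ d, a = b + d ∧ (b + l + a + (b + l + 1 - b) - 1) ^ 2 / 4 =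
      (b + l) * (b + l) + (b + l) * d + d ^ 2 / 4) ∨
      ∃ d, 0 < d ∧ b = a + d ∧ (b + l + a + (b + l + 1 - b) - 1) ^ 2 / 4 + (b + l) * d =
      (b + l) * (b + l) + d ^ 2 / 4 := by
    rcases le_or_gt b a with hba | hab
    · obtain ⟨d, rfl⟩ := Nat.exists_eq_add_of_le hba
      refine .inl ⟨d, rfl, ?_⟩
      rw [show b + l + (b + d) + (b + l + 1 - b) - 1 = 2 * (b + l) + d by omega,
        show (2 * (b + l) + d) ^ 2 = d ^ 2 + ((b + l) * (b + l) + (b + l) * d) * 4 by ring]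
      omega
    · obtain ⟨d, rfl⟩ := Nat.exists_eq_add_of_le hab.le
      refine .inr ⟨d, by omega, rfl, ?_⟩
      rw [show a + d + l + a + (a + d + l + 1 - (a + d)) - 1 = 2 * a + 2 * l + d by omega,
        show (2 * a + 2 * l + d) ^ 2 = d ^ 2 + (a + d + l) * (a + l) * 4 by ring,
        Nat.add_mul_div_right _ _ (by norm_num)]
      ring
  have two_le {d : ℕ} (hd : 2 ≤ d) : 1 ≤ d ^ 2 / 4 := by
    rw [Nat.le_div_iff_mul_le (by norm_num)]
    nlinarith
  rcases key with ⟨d, rfl, hd⟩ | ⟨d, hpos, rfl, hd⟩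
  · rcases (show d = 0 ∨ d = 1 ∨ 2 ≤ d by omega) with rfl | rfl | h2
    · simp only [add_zero] at h hd ⊢
      convert h using 1
      · rw [hd]; ring
      · rw [show b + l + b + (b + l + 1 - b) = 2 * (b + l) + 1 by omega,
          show (2 * (b + l) + 1) / 2 = b + l by omega, tridiag, if_pos rfl,
          if_neg (Nat.not_even_two_mul_add_one _)]
        congr 2
        grind
    · convert h using 1
      · rw [hd]; ring
      · rw [show b + l + (b + 1) + (b + l + 1 - b) = 2 * (b + l + 1) by omega,
          Nat.mul_div_cancel_left _ two_pos, tridiag, if_neg (by omega), if_pos rfl,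
          if_neg (by omega), if_pos (even_two_mul _)]
        ring
    · rw [tridiag, if_neg (by omega), if_neg (by omega), if_neg (by omega), mul_zero]
      refine h.of_lt ?_
      have := two_le h2
      rw [hd]
      nlinarith
  · rcases (show d = 1 ∨ 2 ≤ d by omega) with rfl | h2
    · convert h using 1
      · generalize (a + 1 + l + a + (a + 1 + l + 1 - (a + 1)) - 1) ^ 2 / 4 = z at hd ⊢
        rw [one_pow, show 1 / 4 = 0 from rfl] at hd
        linarith
      · rw [show a + 1 + l + a + (a + 1 + l + 1 - (a + 1)) = 2 * (a + 1 + l) by omega,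
          Nat.mul_div_cancel_left _ two_pos, tridiag, if_neg (by omega), if_neg (by omega),
          if_pos rfl, if_neg (by omega), if_pos (even_two_mul _)]
    · rw [tridiag, if_neg (by omega), if_neg (by omega), if_neg (by omega), mul_zero]
      refine h.of_lt ?_
      have := two_le h2
      nlinarith

/-- The order of the entries on the antidiagonal. -/
def antidiagOrder (ρ N i : ℕ) : ℕ := if i < ρ then i * (N - i) else ρ * (N - ρ)

theorem leadsWith_det_hankelRow (α μ : R) {n ρ m : ℕ} (hn : n = ρ + m) (hm : ρ ≤ m)
    (L : ℕ → ℕ → R)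
    (hL : ∀ a < m, ∀ b < m, LeadsWith (X ^ minSum ρ (ρ + b) * hankelRow α μ (ρ + a) (m - b))
      (minSum ρ (ρ + a) + ρ * (n - 1 - ρ)) (L a b)) :
    LeadsWith (Matrix.of fun i k : Fin n => hankelRow α μ i (n - k)).det
      (∑ i ∈ Finset.range n, antidiagOrder ρ (n - 1) i)
      ((∏ i ∈ Finset.range ρ, -((-1) ^ i * α ^ (n - 1 - i))) *
        (Matrix.of fun a b : Fin m => L a b).det) := by
  have h (i k : ℕ) (hi : i < n) (hk : k < n) : ∃ c,
      LeadsWith (X ^ minSum ρ k * hankelRow α μ i (n - k))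
        (minSum ρ i + antidiagOrder ρ (n - 1) i) c ∧
      (i < ρ → k = i → c = -((-1) ^ i * α ^ (n - 1 - i))) ∧ (i < ρ → i < k → c = 0) ∧
      (ρ ≤ i → ρ ≤ k → c = L (i - ρ) (k - ρ)) := by
    rw [antidiagOrder]
    split_ifs with hiρ
    · obtain ⟨c, hc, h1, h2⟩ := leadsWith_upper_row α μ (n := n) (by omega) hiρ hk
      exact ⟨c, hc, fun _ => h1, fun _ => h2, by omega⟩
    · rcases lt_or_ge k ρ with hkρ | hkρ
      · obtain ⟨c, hc⟩ := leadsWith_lower_left α μ (n := n) (by omega) (show ρ ≤ i by omega) hkρ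
        exact ⟨c, hc, by omega, by omega, by omega⟩
      · refine ⟨_, ?_, by omega, by omega, fun _ _ => rfl⟩
        have := hL (i - ρ) (by omega) (k - ρ) (by omega)
        rwa [Nat.add_sub_cancel' hkρ, Nat.add_sub_cancel' (show ρ ≤ i by omega),
          show m - (k - ρ) = n - k by omega] at this
  choose! G hG h1 h2 h3 using h
  have hdet := LeadsWith.det (M := Matrix.of fun i k : Fin n => hankelRow α μ i (n - k))
    (G := Matrix.of fun i k : Fin n => G i k) (t := fun i : Fin n => minSum ρ i)
    (a := fun i : Fin n => antidiagOrder ρ (n - 1) i) fun i k => hG i k i.2 k.2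
  rw [← Finset.sum_range fun i => antidiagOrder ρ (n - 1) i,
    det_of_zero_right n ρ m hn G fun i hi j hj hij => h2 i j (by omega) hj hi hij] at hdet
  convert hdet using 2
  · refine Finset.prod_congr rfl fun i hi => ?_
    have := Finset.mem_range.1 hi
    exact (h1 i i (by omega) (by omega) this rfl).symm
  · congr 1
    ext a b
    rw [Matrix.of_apply, Matrix.of_apply,
      h3 _ _ (by omega) (by omega) (by omega) (by omega), Nat.add_sub_cancel_left,
      Nat.add_sub_cancel_left]

theorem six_mul_sum_range_mul_sub {q N : ℕ} (h : q ≤ N + 1) :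
    6 * ((∑ i ∈ Finset.range q, i * (N - i) : ℕ) : ℤ) =
      3 * N * q * (q - 1) - (q - 1) * q * (2 * q - 1) := by
  induction q with
  | zero => simp
  | succ q ih =>
    rw [Finset.sum_range_succ, Nat.cast_add, mul_add, ih (by omega), Nat.cast_mul,
      Nat.cast_sub (by omega)]
    push_cast
    ring

theorem neg_one_pow_mul_self (k : ℕ) : (-1 : R) ^ k * (-1) ^ k = 1 := by
  rw [← mul_pow]
  simp

theorem two_mul_sum_range_sub {q N : ℕ} (h : q ≤ N + 1) :
    2 * ((∑ i ∈ Finset.range q, (N - i) : ℕ) : ℤ) = 2 * N * q - q * (q - 1) := by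
  induction q with
  | zero => simp
  | succ q ih =>
    rw [Finset.sum_range_succ, Nat.cast_add, mul_add, ih (by omega), Nat.cast_sub (by omega)]
    push_cast
    ring

theorem sum_antidiagOrder (ρ m : ℕ) :
    ∑ i ∈ Finset.range (ρ + m), antidiagOrder ρ (ρ + m - 1) i =
      ∑ i ∈ Finset.range ρ, i * (ρ + m - 1 - i) + m * (ρ * (m - 1)) := by
  rw [Finset.sum_range_add]
  congr 1
  · exact Finset.sum_congr rfl fun i hi => if_pos (Finset.mem_range.1 hi)
  · simp [antidiagOrder, show ρ + m - 1 - ρ = m - 1 by omega]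

theorem sum_antidiagOrder_even {n p : ℕ} (hn : n = p + p) :
    ∑ i ∈ Finset.range n, antidiagOrder p (n - 1) i = n * (n - 2) * (5 * n - 2) / 24 := by
  subst hn
  refine (Nat.div_eq_of_eq_mul_right (by norm_num) ?_).symm
  rw [sum_antidiagOrder]
  cases p with
  | zero => simp
  | succ r =>
    have h := six_mul_sum_range_mul_sub (q := r + 1) (N := r + 1 + (r + 1) - 1) (by omega)
    generalize ∑ i ∈ Finset.range (r + 1), i * (r + 1 + (r + 1) - 1 - i) = S at h ⊢
    rw [show r + 1 + (r + 1) - 1 = 2 * r + 1 by omega] at h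
    rw [show r + 1 + (r + 1) - 2 = 2 * r by omega,
      show 5 * (r + 1 + (r + 1)) - 2 = 10 * r + 8 by omega, Nat.add_sub_cancel]
    zify
    push_cast at h
    linear_combination -4 * h

theorem sum_antidiagOrder_odd {n m : ℕ} (hn : n = m + (m + 1)) :
    ∑ i ∈ Finset.range n, antidiagOrder m (n - 1) i = n * (n - 1) * (5 * n - 7) / 24 := by
  subst hn
  refine (Nat.div_eq_of_eq_mul_right (by norm_num) ?_).symm
  rw [sum_antidiagOrder]
  cases m with
  | zero => simp
  | succ r =>
    have h := six_mul_sum_range_mul_sub (q := r + 1) (N := r + 1 + (r + 1 + 1) - 1) (by omega)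
    generalize ∑ i ∈ Finset.range (r + 1), i * (r + 1 + (r + 1 + 1) - 1 - i) = S at h ⊢
    rw [show r + 1 + (r + 1 + 1) - 1 = 2 * r + 2 by omega] at h ⊢
    rw [show 5 * (r + 1 + (r + 1 + 1)) - 7 = 10 * r + 8 by omega, Nat.add_sub_cancel]
    zify
    push_cast at h
    linear_combination -4 * h

theorem prod_neg_one_pow_mul_pow (α : R) (q N : ℕ) :
    ∏ i ∈ Finset.range q, -((-1) ^ i * α ^ (N - i)) =
      (-1) ^ (q * (q + 1) / 2) * α ^ ∑ i ∈ Finset.range q, (N - i) := by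
  have h : ∑ i ∈ Finset.range q, (i + 1) = q * (q + 1) / 2 := by
    have := Finset.sum_range_id (q + 1)
    rw [Finset.sum_range_succ', add_zero, Nat.add_sub_cancel, mul_comm] at this
    exact this
  rw [← h, ← Finset.prod_pow_eq_pow_sum, ← Finset.prod_pow_eq_pow_sum, ← Finset.prod_mul_distrib]
  exact Finset.prod_congr rfl fun i _ => by ring

theorem leadsWith_det_hankel_even (α μ : R) {n p : ℕ} (hn : n = p + p) :
    LeadsWith (Matrix.of fun i j : Fin n => hankelRow α μ 0 (i + j + 1)).det
      (n * (n - 2) * (5 * n - 2) / 24)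
      ((-1) ^ (n * (n + 2) / 8) * α ^ (n * (5 * n - 2) / 8) * μ ^ (n / 2)) := by
  have hL (a b : ℕ) (hb : b < p) : ∃ c,
      LeadsWith (X ^ minSum p (p + b) * hankelRow α μ (p + a) (p - b))
        (minSum p (p + a) + p * (n - 1 - p)) c ∧
        (a = b → c = (-α) ^ p * μ) ∧ (a < b → c = 0) := by
    rw [show n - 1 - p = p - 1 by omega]
    exact leadsWith_lower_right_even α μ hb
  choose! L hL h1 h2 using hL
  have h := leadsWith_det_hankelRow α μ hn le_rfl L fun a _ b hb => hL a b hb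
  have hdet : (Matrix.of fun a b : Fin p => L a b).det = ((-α) ^ p * μ) ^ p := by
    rw [det_of_zero_right p p 0 rfl L fun i _ j hj hij => h2 i j hj hij, Matrix.det_fin_zero,
      mul_one, Finset.prod_congr rfl fun i hi => h1 i i (Finset.mem_range.1 hi) rfl,
      Finset.prod_const, Finset.card_range]
  rw [hdet, sum_antidiagOrder_even hn, prod_neg_one_pow_mul_pow] at h
  have h' := h.C_mul ((-1) ^ (n * (n - 1) / 2))
  rw [det_hankel_eq_det_hankelRow, det_eq_det_rev (hankelRow α μ)]
  simp only [map_pow, map_neg, map_one] at h'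
  convert h' using 1
  rcases p with _ | r
  · simp [hn]
  subst hn
  have hS := two_mul_sum_range_sub (q := r + 1) (N := r + 1 + (r + 1) - 1) (by omega)
  generalize ∑ i ∈ Finset.range (r + 1), (r + 1 + (r + 1) - 1 - i) = S at hS ⊢
  obtain ⟨e, he⟩ := Nat.even_mul_succ_self r
  have e1 : (r + 1 + (r + 1)) * (r + 1 + (r + 1) + 2) / 8 = e + (r + 1) :=
    Nat.div_eq_of_eq_mul_right (by norm_num) (by linarith)
  have e2 : (r + 1 + (r + 1)) * (5 * (r + 1 + (r + 1)) - 2) / 8 = S + (r + 1) * (r + 1) := by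
    refine Nat.div_eq_of_eq_mul_right (by norm_num) ?_
    rw [show 5 * (r + 1 + (r + 1)) - 2 = 10 * r + 8 by omega]
    rw [show r + 1 + (r + 1) - 1 = 2 * r + 1 by omega] at hS
    zify
    push_cast at hS
    linear_combination -4 * hS
  have e3 : (r + 1 + (r + 1)) * (r + 1 + (r + 1) - 1) / 2 = e * 4 + (r + 1) := by
    refine Nat.div_eq_of_eq_mul_right (by norm_num) ?_
    rw [show r + 1 + (r + 1) - 1 = 2 * r + 1 by omega]
    linarith
  have e4 : (r + 1) * (r + 1 + 1) / 2 = e + (r + 1) :=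
    Nat.div_eq_of_eq_mul_right (by norm_num) (by linarith)
  have e5 : (r + 1) * (r + 1) = e * 2 + (r + 1) := by linarith
  rw [e1, e2, e3, e4, mul_pow, ← pow_mul, e5, neg_pow α, ← two_mul (r + 1),
    Nat.mul_div_cancel_left _ two_pos]
  simp only [pow_add _ e, pow_add _ (e * _), pow_add α S, pow_mul _ e]
  have hs := neg_one_pow_mul_self (R := R) e
  have ht := neg_one_pow_mul_self (R := R) (r + 1)
  generalize (-1 : R) ^ e = s at hs ⊢
  generalize (-1 : R) ^ (r + 1) = t at ht ⊢
  generalize α ^ (r + 1) = x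
  generalize α ^ e = y
  generalize μ ^ (r + 1) = z
  generalize α ^ S = w
  clear * - hs ht
  grind

/-- The number `K_m(α, μ)` is a tridiagonal determinant. -/
theorem det_hessenberg_eq_det_tridiag (α μ : R) (m : ℕ) :
    Matrix.det (Matrix.of fun i j : Fin (m + 1) =>
      if (j : ℕ) = (i : ℕ) then μ - 1
      else if (j : ℕ) + 1 = (i : ℕ) then μ
      else if (i : ℕ) < (j : ℕ) then -α ^ ((j : ℕ) - (i : ℕ))
      else 0) = (Matrix.of fun a b : Fin (m + 1) => tridiag α μ a b).det := by
  rw [← Matrix.det_transpose (Matrix.of fun a b : Fin (m + 1) => tridiag α μ a b)]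
  refine Matrix.det_eq_of_forall_col_eq_smul_add_pred (fun _ => α) (fun i => ?_) fun i j => ?_
  · simp only [Matrix.of_apply, Matrix.transpose_apply, tridiag, Fin.val_zero]
    grind
  · simp only [Matrix.of_apply, Matrix.transpose_apply, tridiag, Fin.val_succ, Fin.val_castSucc]
    rcases lt_trichotomy (i : ℕ) j with h | h | h
    · obtain ⟨d, hd⟩ := Nat.exists_eq_add_of_lt h
      have h1 : (i : ℕ) + d + 1 + 1 - i = d + 2 := by omega
      have h2 : (i : ℕ) + d + 1 - i = d + 1 := by omega
      simp only [hd]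
      grind
    · simp [h]
      grind
    · grind

theorem leadsWith_det_hankel_odd (α μ : R) {n m : ℕ} (hn : n = m + (m + 1)) :
    LeadsWith (Matrix.of fun i j : Fin n => hankelRow α μ 0 (i + j + 1)).det
      (n * (n - 1) * (5 * n - 7) / 24)
      ((-1) ^ ((n - 1) * (n - 3) / 8) * α ^ ((n - 1) * (5 * n + 1) / 8) *
        (Matrix.of fun a b : Fin (m + 1) => tridiag α μ a b).det) := by
  have h := leadsWith_det_hankelRow α μ hn (Nat.le_succ m)
    (fun a b => (-α) ^ m * tridiag α μ a b) fun a _ b hb => by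
      rw [show n - 1 - m = m by omega]
      exact leadsWith_lower_right_odd α μ (by omega)
  have hdet : (Matrix.of fun a b : Fin (m + 1) => (-α) ^ m * tridiag α μ a b).det =
      ((-α) ^ m) ^ (m + 1) * (Matrix.of fun a b : Fin (m + 1) => tridiag α μ a b).det := by
    have := Matrix.det_smul (Matrix.of fun a b : Fin (m + 1) => tridiag α μ a b) ((-α) ^ m)
    rwa [Fintype.card_fin] at this
  rw [hdet, sum_antidiagOrder_odd hn, prod_neg_one_pow_mul_pow] at h
  have h' := h.C_mul ((-1) ^ (n * (n - 1) / 2))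
  rw [det_hankel_eq_det_hankelRow, det_eq_det_rev (hankelRow α μ)]
  simp only [map_pow, map_neg, map_one] at h'
  convert h' using 1
  generalize (Matrix.of fun a b : Fin (m + 1) => tridiag α μ a b).det = K
  rcases m with _ | r
  · simp [hn]
  subst hn
  have hS := two_mul_sum_range_sub (q := r + 1) (N := r + 1 + (r + 1 + 1) - 1) (by omega)
  generalize ∑ i ∈ Finset.range (r + 1), (r + 1 + (r + 1 + 1) - 1 - i) = S at hS ⊢
  obtain ⟨e, he⟩ := Nat.even_mul_succ_self r
  rw [show r + 1 + (r + 1 + 1) - 3 = 2 * r by omega]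
  rw [show r + 1 + (r + 1 + 1) - 1 = 2 * r + 2 by omega] at hS ⊢
  have e1 : (2 * r + 2) * (2 * r) / 8 = e :=
    Nat.div_eq_of_eq_mul_right (by norm_num) (by linarith)
  have e5 : (r + 1) * (r + 1 + 1) = e * 2 + (r + 1) * 2 := by linarith
  have e2 : (2 * r + 2) * (5 * (r + 1 + (r + 1 + 1)) + 1) / 8 = S + (e * 2 + (r + 1) * 2) := by
    refine Nat.div_eq_of_eq_mul_right (by norm_num) ?_
    rw [← e5]
    zify
    push_cast at hS
    linear_combination -4 * hS
  have e3 : (r + 1 + (r + 1 + 1)) * (2 * r + 2) / 2 = e * 4 + (r + 1) * 3 :=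
    Nat.div_eq_of_eq_mul_right (by norm_num) (by linarith)
  have e4 : (r + 1) * (r + 1 + 1) / 2 = e + (r + 1) :=
    Nat.div_eq_of_eq_mul_right (by norm_num) (by linarith)
  rw [e1, e2, e3, e4, ← pow_mul, e5, neg_pow α]
  simp only [pow_add _ e, pow_add _ (e * _), pow_add α S, pow_mul _ e, pow_mul _ (r + 1)]
  have hs := neg_one_pow_mul_self (R := R) e
  have ht := neg_one_pow_mul_self (R := R) (r + 1)
  generalize (-1 : R) ^ e = s at hs ⊢
  generalize (-1 : R) ^ (r + 1) = t at ht ⊢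
  generalize α ^ (r + 1) = x
  generalize α ^ e = y
  grind

end

theorem stmt_7 (α μ : ℂ)
    (v : ℕ → Polynomial ℂ) (hv0 : v 0 = C (μ - 1))
    (hv : ∀ n : ℕ, v (n + 1) = X ^ (n + 1) * v n - C (α ^ (n + 1)))
    (V : ℕ → Polynomial ℂ)
    (hV : ∀ n : ℕ, V n = Matrix.det (Matrix.of fun i j : Fin n => v ((i : ℕ) + (j : ℕ))))
    (e₀ : ℕ → ℕ)
    (he₀ : ∀ n : ℕ, e₀ n = if Even n then n * (n - 2) * (5 * n - 2) / 24
                           else n * (n - 1) * (5 * n - 7) / 24)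
    (n : ℕ) (hn : 1 ≤ n) :
    (∀ k < e₀ n, (V n).coeff k = 0) ∧
    (V n).coeff (e₀ n) =
      (if Even n then
        (-1) ^ (n * (n + 2) / 8) * α ^ (n * (5 * n - 2) / 8) * μ ^ (n / 2)
      else
        (-1) ^ ((n - 1) * (n - 3) / 8) * α ^ ((n - 1) * (5 * n + 1) / 8) *
          Kdet α μ ((n - 1) / 2)) := by
  have hrow (k : ℕ) : v k = hankelRow α μ 0 (k + 1) := by
    induction k with
    | zero => simp [hv0, hankelRow]
    | succ k ih => rw [hv, ih, hankelRow.eq_2 α μ (k + 1)]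
  have h : LeadsWith (V n) (e₀ n) (if Even n then
        (-1) ^ (n * (n + 2) / 8) * α ^ (n * (5 * n - 2) / 8) * μ ^ (n / 2)
      else
        (-1) ^ ((n - 1) * (n - 3) / 8) * α ^ ((n - 1) * (5 * n + 1) / 8) *
          Kdet α μ ((n - 1) / 2)) := by
    rw [hV, he₀]
    simp only [hrow]
    split_ifs with heven
    · obtain ⟨p, hp⟩ := heven
      exact leadsWith_det_hankel_even α μ hp
    · obtain ⟨m, hm⟩ := Nat.not_even_iff_odd.1 heven
      have := leadsWith_det_hankel_odd α μ (m := m) (by omega : n = m + (m + 1))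
      rwa [← det_hessenberg_eq_det_tridiag, ← Kdet,
        show m = (n - 1) / 2 by omega] at this
  exact ⟨fun k hk => h.coeff_of_lt hk, h.coeff_eq⟩
end

section
/- Let α and μ be complex numbers, and for m ≥ 0 let K_m = K_m(α,μ) be the determinant of the (m+1)×(m+1) matrix whose (i,j) entry (0 ≤ i,j ≤ m) is μ−1 if j = i, μ if j = i−1, −α^{j−i} if j > i, and 0 if j < i−1. Then K_0 = μ−1, K_1 = (μ−1)² + αμ, and the sequence satisfies the linear recurrence K_{m+2} = (μ − 1 − αμ)·K_{m+1} + αμ²·K_m for all m ≥ 0. -/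
/-- Subtracting `α` times the second row from the first leaves two nonzero entries in the first
row; expanding along it gives the recurrence. -/
theorem Kdet_add_two (α μ : ℂ) (m : ℕ) :
    Kdet α μ (m + 2) = (μ - 1 - α * μ) * Kdet α μ (m + 1) + α * μ ^ 2 * Kdet α μ m := by
  unfold Kdet
  set A : Matrix (Fin (m + 3)) (Fin (m + 3)) ℂ := Matrix.of fun i j =>
    if (j : ℕ) = (i : ℕ) then μ - 1
    else if (j : ℕ) + 1 = (i : ℕ) then μ
    else if (i : ℕ) < (j : ℕ) then -α ^ ((j : ℕ) - (i : ℕ))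
    else 0 with hA
  set B := A.updateRow 0 (A 0 + (-α) • A 1) with hB
  have hdet : A.det = B.det := (Matrix.det_updateRow_add_smul_self A (by simp) (-α)).symm
  have h0 : B 0 0 = μ - 1 - α * μ := by
    simp [hB, hA]
    ring
  have h1 : B 0 1 = -(α * μ) := by
    simp [hB, hA]
    ring
  have h2 (j : Fin (m + 1)) : B 0 j.succ.succ = 0 := by
    have hj : (1 : Fin (m + 3)) < j.succ.succ := by simp [Fin.lt_def]
    simp [hB, hA, hj]
    ring
  have hminor : (B.submatrix Fin.succ (Fin.succAbove 1)).det = μ * Kdet α μ m := by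
    rw [Matrix.det_succ_column_zero, Fin.sum_univ_succ, Finset.sum_eq_zero]
    · have hentry : B 1 0 = μ := by simp [hB, hA]
      simp only [Fin.val_zero, pow_zero, one_mul, Matrix.submatrix_apply, add_zero]
      refine congrArg₂ (· * ·) hentry (congrArg Matrix.det ?_)
      ext i j
      have hj : Fin.succAbove (1 : Fin (m + 3)) j.succ = j.succ.succ := by
        exact Fin.succ_succAbove_succ (0 : Fin (m + 2)) j
      simp [hB, hA, hj]
    · intro i _
      simp [hB, hA]
  have hcorner : (B.submatrix Fin.succ (Fin.succAbove 0)).det = Kdet α μ (m + 1) := by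
    unfold Kdet
    congr 1
    ext i j
    simp [hB, hA]
  rw [hdet, Matrix.det_succ_row_zero, Fin.sum_univ_succ, Fin.sum_univ_succ, Finset.sum_eq_zero]
  · simp only [Fin.succ_zero_eq_one, h0, h1, hminor, hcorner, Fin.val_zero, Fin.val_one]
    unfold Kdet
    ring
  · intro j _
    simp [h2]

theorem stmt_8 (α μ : ℂ) :
    Kdet α μ 0 = μ - 1 ∧
    Kdet α μ 1 = (μ - 1) ^ 2 + α * μ ∧
    ∀ m : ℕ, Kdet α μ (m + 2) = (μ - 1 - α * μ) * Kdet α μ (m + 1) + α * μ ^ 2 * Kdet α μ m := by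
  refine ⟨by simp [Kdet], ?_, Kdet_add_two α μ⟩
  simp [Kdet, Matrix.det_fin_two]
  ring
end
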